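/- arXiv:2304.03256 — 2 statements merged into one kernel-verified Lean document; each statement's English description precedes it below -/
import Mathlib

section
/- For every integer k ≥ 3 there exists a finite simple graph H together with three distinct vertices p₁, p₂, n, each of degree 1 in H, with incident edges e₁, e₂, e respectively, such that: (i) for every partition of the three-element set {e₁, e₂, e} into sets F̃ and M̃ such that neither {e₁, e} nor {e₂, e} is contained in F̃, there exists a partition (F, M) of the edge set of H into a k-bounded linear forest F and a matching M with F̃ ⊆ F and M̃ ⊆ M; and (ii) for every partition (F, M) of the edge set of H into a k-bounded linear forest F and a matching M, neither {e₁, e} nor {e₂, e} is contained in F. -/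
/-- `M` is a matching in `G`: a set of pairwise vertex-disjoint edges of `G`. -/
def IsMatchingIn {V : Type} (G : SimpleGraph V) (M : Set (Sym2 V)) : Prop :=
  M ⊆ G.edgeSet ∧ ∀ e ∈ M, ∀ f ∈ M, e ≠ f → ∀ v : V, v ∈ e → v ∉ f

/-- `F` is a `k`-bounded linear forest in `G`: a set of edges of `G` spanning a graph with
no cycle, maximum degree at most `2`, and no path with `k+1` edges. -/
def IsBddLinearForestIn {V : Type} (G : SimpleGraph V) (k : ℕ) (F : Set (Sym2 V)) : Prop :=
  F ⊆ G.edgeSet ∧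
  (SimpleGraph.fromEdgeSet F).IsAcyclic ∧
  (∀ v : V, {e ∈ F | v ∈ e}.ncard ≤ 2) ∧
  (∀ (u w : V) (p : (SimpleGraph.fromEdgeSet F).Walk u w), p.IsPath → p.length ≤ k)

/-- `(F, M)` is a partition of the edge set of `G` into a `k`-bounded linear forest `F`
and a matching `M`. -/
def IsMLFDecomp {V : Type} (G : SimpleGraph V) (k : ℕ) (F M : Set (Sym2 V)) : Prop :=
  F ∪ M = G.edgeSet ∧ Disjoint F M ∧ IsBddLinearForestIn G k F ∧ IsMatchingIn G M

namespace MLFTree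

open SimpleGraph

theorem isBddLinearForestIn_of_cert {V C : Type} {G : SimpleGraph V} {k : ℕ} {F : Set (Sym2 V)}
    (hF : F ⊆ G.edgeSet) (comp : V → C) (pos : V → ℕ)
    (hstep : ∀ u v, s(u, v) ∈ F → comp u = comp v ∧ (pos u = pos v + 1 ∨ pos v = pos u + 1))
    (hinj : ∀ u v, comp u = comp v → pos u = pos v → u = v) (hk : ∀ v, pos v ≤ k) :
    IsBddLinearForestIn G k F := by
  classical
  refine ⟨hF, ?_, ?_, ?_⟩
  · intro v c hc
    obtain ⟨u, hu, hmax⟩ := c.support.toFinset.exists_max_image pos ⟨v, by simp⟩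
    rw [List.mem_toFinset] at hu
    have hc' := hc.rotate hu
    have hmax' : ∀ w ∈ (c.rotate u hu).support, pos w ≤ pos u := by
      intro w hw
      exact hmax w (by simpa using (Walk.mem_support_rotate_iff _ _ hu).1 hw)
    have h1 := (c.rotate u hu).adj_snd hc'.not_nil
    have h2 := (c.rotate u hu).adj_penultimate hc'.not_nil
    have h3 := hmax' _ ((c.rotate u hu).getVert_mem_support 1)
    have h4 := hmax' _ ((c.rotate u hu).getVert_mem_support ((c.rotate u hu).length - 1))
    have h1' := hstep _ _ ((fromEdgeSet_adj _).1 h1).1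
    have h2' := hstep _ _ ((fromEdgeSet_adj _).1 h2).1
    refine hc'.snd_ne_penultimate (hinj _ _ (h1'.1.symm.trans h2'.1.symm) ?_)
    simp only [Walk.snd, Walk.penultimate] at *
    omega
  · intro v
    have key : ∀ m, ∃ a, ∀ w, s(v, w) ∈ F → pos w = m → w = a := by
      intro m
      by_cases h : ∃ a, s(v, a) ∈ F ∧ pos a = m
      · obtain ⟨a, ha, hm⟩ := h
        exact ⟨a, fun w hw hwm => hinj _ _ ((hstep _ _ hw).1.symm.trans (hstep _ _ ha).1)
          (hwm.trans hm.symm)⟩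
      · exact ⟨v, fun w hw hwm => absurd ⟨w, hw, hwm⟩ h⟩
    obtain ⟨a, ha⟩ := key (pos v + 1)
    obtain ⟨b, hb⟩ := key (pos v - 1)
    refine (Set.ncard_le_ncard (t := {s(v, a), s(v, b)}) ?_ (by simp)).trans
      ((Set.ncard_insert_le _ _).trans (by simp))
    rintro e ⟨he, hv⟩
    obtain ⟨w, rfl⟩ := Sym2.mem_iff_exists.1 hv
    rcases (hstep _ _ he).2 with h | h
    · right; rw [Set.mem_singleton_iff, hb w he (by omega)]
    · left; rw [ha w he h]
  · intro u w p hp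
    have hcomp : ∀ {u w} (p : (fromEdgeSet F).Walk u w), ∀ x ∈ p.support, comp x = comp u := by
      intro u w p
      induction p with
      | nil => simp
      | cons h p ih =>
        intro x hx
        rcases List.mem_cons.1 (by simpa using hx) with rfl | hx
        · rfl
        · exact (ih x hx).trans (hstep _ _ ((fromEdgeSet_adj _).1 h).1).1.symm
    have h1 : (p.support.map pos).Nodup := hp.support_nodup.map_on fun x hx y hy hxy =>
      hinj x y ((hcomp p x hx).trans (hcomp p y hy).symm) hxy
    have h2 : (p.support.map pos).toFinset ⊆ Finset.range (k + 1) := by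
      intro m hm
      simp only [List.mem_toFinset, List.mem_map] at hm
      obtain ⟨x, -, rfl⟩ := hm
      simpa [Nat.lt_succ_iff] using hk x
    have h3 := Finset.card_le_card h2
    rw [List.toFinset_card_of_nodup h1] at h3
    simpa using h3

theorem exists_walk_of_isChain {V : Type} {G : SimpleGraph V} (x : V) (L : List V)
    (h : (x :: L).IsChain G.Adj) : ∃ (y : V) (p : G.Walk x y), p.support = x :: L := by
  induction L generalizing x with
  | nil => exact ⟨x, Walk.nil, rfl⟩
  | cons y L ih =>
    rw [List.isChain_cons_cons] at h
    obtain ⟨z, p, hp⟩ := ih y h.2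
    exact ⟨z, Walk.cons h.1 p, by simp [hp]⟩

/-- Binary trees whose leaves may carry a label `false` or `true`. A tree `t` represents a
graph on its nodes together with one further vertex, attached to the top node by a pendant edge. -/
inductive BTree where
  | leaf (o : Option Bool)
  | un (c : BTree)
  | bin (l r : BTree)

namespace BTree

/-- The addresses of the nodes of a tree whose top node has address `a`; the tail of an address is
the address of its parent. -/
def nodes : BTree → List Bool → Finset (List Bool)
  | leaf _, a => {a}
  | un c, a => insert a (c.nodes (false :: a))
  | bin l r, a => insert a (l.nodes (false :: a) ∪ r.nodes (true :: a))

/-- The leaf with label `b` has address `w` when the top node has address `a`. -/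
def HasLabel (b : Bool) : BTree → List Bool → List Bool → Prop
  | leaf o, a, w => o = some b ∧ w = a
  | un c, a, w => c.HasLabel b (false :: a) w
  | bin l r, a, w => l.HasLabel b (false :: a) w ∨ r.HasLabel b (true :: a) w

/-- `State k σ t n` describes the admissible colourings of the edges of `t` (including the edge
above its top node) in which the edge above the leaf labelled `b` is in the forest iff `σ b`:
the edge above the top node is in the matching if `n = 0`, and otherwise it is in the forest and
the forest path descending through it has `n` edges. -/
inductive State (k : ℕ) (σ : Bool → Prop) : BTree → ℕ → Prop
  | leaf_zero {o} (h : ∀ b, o = some b → ¬ σ b) : State k σ (leaf o) 0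
  | leaf_one {o} (h : ∀ b, o = some b → σ b) : State k σ (leaf o) 1
  | un_zero {c j} (h : State k σ c j) (hj : 1 ≤ j) : State k σ (un c) 0
  | un_succ {c j} (h : State k σ c j) (hj : j + 1 ≤ k) : State k σ (un c) (j + 1)
  | bin_zero {l r i j} (hl : State k σ l i) (hr : State k σ r j) (hi : 1 ≤ i) (hj : 1 ≤ j)
      (hij : i + j ≤ k) : State k σ (bin l r) 0
  | bin_left {l r i} (hl : State k σ l i) (hr : State k σ r 0) (hi : 1 ≤ i) (hk : i + 1 ≤ k) :
      State k σ (bin l r) (i + 1)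
  | bin_right {l r j} (hl : State k σ l 0) (hr : State k σ r j) (hj : 1 ≤ j) (hk : j + 1 ≤ k) :
      State k σ (bin l r) (j + 1)

theorem self_mem_nodes (t : BTree) (a : List Bool) : a ∈ t.nodes a := by
  cases t <;> simp [nodes]

theorem suffix_of_mem_nodes {t : BTree} {a w : List Bool} (h : w ∈ t.nodes a) : a <:+ w := by
  induction t generalizing a with
  | leaf o => simp [nodes] at h; simp [h]
  | un c ih =>
    rcases Finset.mem_insert.1 h with rfl | h
    · exact List.suffix_refl _
    · exact (List.suffix_cons _ _).trans (ih h)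
  | bin l r ihl ihr =>
    simp only [nodes, Finset.mem_insert, Finset.mem_union] at h
    rcases h with rfl | h | h
    · exact List.suffix_refl _
    · exact (List.suffix_cons _ _).trans (ihl h)
    · exact (List.suffix_cons _ _).trans (ihr h)

theorem tail_mem_nodes {t : BTree} {a w : List Bool} (h : w ∈ t.nodes a) (hw : w ≠ a) :
    w.tail ∈ t.nodes a := by
  induction t generalizing a with
  | leaf o => simp [nodes] at h; exact absurd h hw
  | un c ih =>
    simp only [nodes, Finset.mem_insert] at h ⊢
    have := @ih (false :: a)
    by_cases h' : w = false :: a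
    · simp [h']
    · tauto
  | bin l r ihl ihr =>
    simp only [nodes, Finset.mem_insert, Finset.mem_union] at h ⊢
    have h1 := @ihl (false :: a)
    have h2 := @ihr (true :: a)
    by_cases h' : w = false :: a
    · simp [h']
    by_cases h'' : w = true :: a
    · simp [h'']
    tauto

theorem not_mem_nodes_cons (t : BTree) (x : Bool) (a : List Bool) : a ∉ t.nodes (x :: a) :=
  fun h => by simpa using (suffix_of_mem_nodes h).length_le

theorem notMem_nodes_of_mem_nodes {l r : BTree} {a w : List Bool} {x y : Bool} (hxy : x ≠ y)
    (h : w ∈ l.nodes (x :: a)) : w ∉ r.nodes (y :: a) := fun h' => by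
  have := List.suffix_of_suffix_length_le (suffix_of_mem_nodes h) (suffix_of_mem_nodes h')
    (by simp)
  have := this.eq_of_length (by simp)
  simp_all

theorem HasLabel.mem_nodes {b : Bool} {t : BTree} {a w : List Bool} (h : t.HasLabel b a w) :
    w ∈ t.nodes a := by
  induction t generalizing a with
  | leaf o => simp_all [HasLabel, nodes]
  | un c ih => simp [nodes, ih h]
  | bin l r ihl ihr =>
    rcases h with h | h
    · simp [nodes, ihl h]
    · simp [nodes, ihr h]

theorem HasLabel.cons_notMem_nodes {b : Bool} {t : BTree} {a w : List Bool}
    (h : t.HasLabel b a w) (x : Bool) : x :: w ∉ t.nodes a := by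
  induction t generalizing a with
  | leaf o => simp_all [HasLabel, nodes]
  | un c ih =>
    have h0 := (suffix_of_mem_nodes (HasLabel.mem_nodes h)).length_le
    simp only [nodes, Finset.mem_insert, not_or]
    refine ⟨fun h' => ?_, ih h⟩
    have := congrArg List.length h'
    simp at this h0; omega
  | bin l r ihl ihr =>
    have key : ∀ (c d : BTree) (y z : Bool), y ≠ z → c.HasLabel b (y :: a) w →
        x :: w ≠ a ∧ x :: w ∉ d.nodes (z :: a) := by
      intro c d y z hyz hc
      have hs := suffix_of_mem_nodes hc.mem_nodes
      refine ⟨fun h' => ?_, fun h' => ?_⟩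
      · have := congrArg List.length h'
        have := hs.length_le
        simp at *; omega
      · have := List.suffix_of_suffix_length_le (hs.trans (List.suffix_cons x w))
          (suffix_of_mem_nodes h') (by simp)
        have := this.eq_of_length (by simp)
        simp_all
    simp only [nodes, Finset.mem_insert, Finset.mem_union, not_or]
    rcases h with h | h
    · exact ⟨(key l r _ _ Bool.false_ne_true h).1, ihl h, (key l r _ _ Bool.false_ne_true h).2⟩
    · exact ⟨(key r l _ _ Bool.false_ne_true.symm h).1,
        (key r l _ _ Bool.false_ne_true.symm h).2, ihr h⟩

/-- A certificate that the tree `t` with top address `x :: p` has the state `n`: `col w` says that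
the edge above `w` is in the forest, while `comp` and `pos` give the forest path containing a vertex
and the position on this path. -/
structure Cert (k : ℕ) (σ : Bool → Prop) (t : BTree) (n : ℕ) (x : Bool) (p : List Bool)
    (col : List Bool → Prop) (comp : List Bool → List Bool) (pos : List Bool → ℕ) : Prop where
  top : col (x :: p) ↔ n ≠ 0
  label : ∀ b w, t.HasLabel b (x :: p) w → (col w ↔ σ b)
  parent : ∀ w ∈ t.nodes (x :: p), w.tail ∈ t.nodes (x :: p) → col w ∨ col w.tail
  sibling : ∀ v ∈ t.nodes (x :: p), ∀ w ∈ t.nodes (x :: p), v ≠ w → v.tail = w.tail →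
    col v ∨ col w
  step : ∀ v ∈ t.nodes (x :: p), col v →
    comp v = comp v.tail ∧ (pos v = pos v.tail + 1 ∨ pos v.tail = pos v + 1)
  inj : ∀ v ∈ insert p (t.nodes (x :: p)), ∀ w ∈ insert p (t.nodes (x :: p)),
    comp v = comp w → pos v = pos w → v = w
  pos_le : ∀ v ∈ t.nodes (x :: p), pos v ≤ k
  comp_root : comp p = p
  pos_root : pos p = 0
  comp_mem : ∀ v ∈ t.nodes (x :: p), comp v = p ∨ comp v ∈ t.nodes (x :: p)
  pos_le_root : ∀ v ∈ t.nodes (x :: p), comp v = p → pos v ≤ n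

theorem Cert.congr {k σ t n x p col comp pos col' comp' pos'}
    (h : Cert k σ t n x p col comp pos)
    (hcol : ∀ v ∈ t.nodes (x :: p), col' v ↔ col v)
    (hcomp : ∀ v ∈ insert p (t.nodes (x :: p)), comp' v = comp v)
    (hpos : ∀ v ∈ insert p (t.nodes (x :: p)), pos' v = pos v) :
    Cert k σ t n x p col' comp' pos' := by
  have hself := self_mem_nodes t (x :: p)
  have htail : ∀ v ∈ t.nodes (x :: p), v.tail ∈ insert p (t.nodes (x :: p)) := by
    intro v hv
    by_cases hv' : v = x :: p
    · simp [hv']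
    · exact Finset.mem_insert_of_mem (tail_mem_nodes hv hv')
  have hlab := fun b w => @HasLabel.mem_nodes b t (x :: p) w
  obtain ⟨h1, h2, h3, h4, h5, h6, h7, h8, h9, h10, h11⟩ := h
  constructor <;> grind

theorem Cert.un_zero {k σ c j x p col comp pos} (h : Cert k σ c j false (x :: p) col comp pos)
    (hj : 1 ≤ j) :
    ∃ col comp pos, Cert k σ (un c) 0 x p col comp pos := by
  have hself := self_mem_nodes c (false :: x :: p)
  have ha := not_mem_nodes_cons c false (x :: p)
  have hp := not_mem_nodes_cons (un c) x p
  have htail := fun w => @tail_mem_nodes c (false :: x :: p) w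
  have hlab := fun b w => @HasLabel.mem_nodes b c (false :: x :: p) w
  have hpx : p ≠ x :: p := by simp
  obtain ⟨h1, h2, h3, h4, h5, h6, h7, h8, h9, h10, h11⟩ := h
  refine ⟨fun w => w ≠ x :: p ∧ col w, fun w => if w = p then p else comp w,
    fun w => if w = p then 0 else pos w, ?_⟩
  simp only [nodes, Finset.mem_insert] at *
  constructor <;> (try simp only [nodes, Finset.mem_insert, HasLabel]) <;> grind

theorem Cert.un_succ {k σ c j x p col comp pos} (h : Cert k σ c j false (x :: p) col comp pos)
    (hj : j + 1 ≤ k) :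
    ∃ col comp pos, Cert k σ (un c) (j + 1) x p col comp pos := by
  have hself := self_mem_nodes c (false :: x :: p)
  have ha := not_mem_nodes_cons c false (x :: p)
  have hp := not_mem_nodes_cons (un c) x p
  have htail := fun w => @tail_mem_nodes c (false :: x :: p) w
  have hlab := fun b w => @HasLabel.mem_nodes b c (false :: x :: p) w
  have hpx : p ≠ x :: p := by simp
  obtain ⟨h1, h2, h3, h4, h5, h6, h7, h8, h9, h10, h11⟩ := h
  refine ⟨fun w => w = x :: p ∨ col w, fun w => if w = p ∨ comp w = x :: p then p else comp w,
    fun w => if w = p then 0 else if comp w = x :: p then pos w + 1 else pos w, ?_⟩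
  simp only [nodes, Finset.mem_insert] at *
  constructor <;> (try simp only [nodes, Finset.mem_insert, HasLabel]) <;> grind

theorem Cert.bin_zero {k σ l r i j x p col comp pos}
    (hl : Cert k σ l i false (x :: p) col comp pos)
    (hr : Cert k σ r j true (x :: p) col comp pos)
    (hi : 1 ≤ i) (hj : 1 ≤ j) (hij : i + j ≤ k) :
    ∃ col comp pos, Cert k σ (bin l r) 0 x p col comp pos := by
  have hselfl := self_mem_nodes l (false :: x :: p)
  have hselfr := self_mem_nodes r (true :: x :: p)
  have hal := not_mem_nodes_cons l false (x :: p)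
  have har := not_mem_nodes_cons r true (x :: p)
  have hp := not_mem_nodes_cons (bin l r) x p
  have htaill := fun w => @tail_mem_nodes l (false :: x :: p) w
  have htailr := fun w => @tail_mem_nodes r (true :: x :: p) w
  have hlabl := fun b w => @HasLabel.mem_nodes b l (false :: x :: p) w
  have hlabr := fun b w => @HasLabel.mem_nodes b r (true :: x :: p) w
  have hd := fun w => @notMem_nodes_of_mem_nodes l r (x :: p) w _ _ Bool.false_ne_true
  have hpx : p ≠ x :: p := by simp
  obtain ⟨h1, h2, h3, h4, h5, h6, h7, h8, h9, h10, h11⟩ := hl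
  obtain ⟨h1', h2', h3', h4', h5', h6', h7', h8', h9', h10', h11'⟩ := hr
  refine ⟨fun w => w ≠ x :: p ∧ col w, fun w => if w = p then p else comp w,
    fun w => if w = p then 0 else if comp w = x :: p then
      if w ∈ l.nodes (false :: x :: p) then i - pos w else i + pos w else pos w, ?_⟩
  simp only [nodes, Finset.mem_insert, Finset.mem_union] at *
  constructor <;> try simp only [nodes, Finset.mem_insert, Finset.mem_union, HasLabel]
  · grind
  · grind
  · have := hi
    clear h5 h6 h7 h8 h9 h10 h11 h5' h6' h7' h8' h9' h10' h11' h4 h4' h2 h2'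
    rintro w (rfl | hw | hw) ht
    · grind
    · by_cases hw' : w = false :: x :: p <;> grind
    · by_cases hw' : w = true :: x :: p <;> grind
  · have hwl : ∀ w ∈ l.nodes (false :: x :: p), w = false :: x :: p ∨
        w.tail ∈ l.nodes (false :: x :: p) ∧ w.tail ≠ p ∧ w.tail ≠ x :: p := by grind
    have hwr : ∀ w ∈ r.nodes (true :: x :: p), w = true :: x :: p ∨
        w.tail ∈ r.nodes (true :: x :: p) ∧ w.tail ≠ p ∧ w.tail ≠ x :: p := by grind
    clear h5 h6 h7 h8 h9 h10 h11 h5' h6' h7' h8' h9' h10' h11' h3 h3' h2 h2'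
      htaill htailr hlabl hlabr
    rintro v (rfl | hv | hv) w (rfl | hw | hw) hvw ht
    · grind
    · rcases hwl w hw with rfl | hw' <;> grind
    · rcases hwr w hw with rfl | hw' <;> grind
    · rcases hwl v hv with rfl | hv' <;> grind
    · grind
    · rcases hwl v hv with rfl | hv' <;> rcases hwr w hw with rfl | hw' <;> grind
    · rcases hwr v hv with rfl | hv' <;> grind
    · rcases hwr v hv with rfl | hv' <;> rcases hwl w hw with rfl | hw' <;> grind
    · grind
  · grind
  · grind
  · grind
  · grind
  · grind
  · grind
  · grind

theorem Cert.bin_succ {k σ l r i j x p col comp pos}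
    (hl : Cert k σ l i false (x :: p) col comp pos)
    (hr : Cert k σ r j true (x :: p) col comp pos)
    (hij : i = 0 ∧ 1 ≤ j ∨ 1 ≤ i ∧ j = 0) (hk : i + j + 1 ≤ k) :
    ∃ col comp pos, Cert k σ (bin l r) (i + j + 1) x p col comp pos := by
  have hselfl := self_mem_nodes l (false :: x :: p)
  have hselfr := self_mem_nodes r (true :: x :: p)
  have hal := not_mem_nodes_cons l false (x :: p)
  have har := not_mem_nodes_cons r true (x :: p)
  have hp := not_mem_nodes_cons (bin l r) x p
  have htaill := fun w => @tail_mem_nodes l (false :: x :: p) w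
  have htailr := fun w => @tail_mem_nodes r (true :: x :: p) w
  have hlabl := fun b w => @HasLabel.mem_nodes b l (false :: x :: p) w
  have hlabr := fun b w => @HasLabel.mem_nodes b r (true :: x :: p) w
  have hd := fun w => @notMem_nodes_of_mem_nodes l r (x :: p) w _ _ Bool.false_ne_true
  have hpx : p ≠ x :: p := by simp
  obtain ⟨h1, h2, h3, h4, h5, h6, h7, h8, h9, h10, h11⟩ := hl
  obtain ⟨h1', h2', h3', h4', h5', h6', h7', h8', h9', h10', h11'⟩ := hr
  refine ⟨fun w => w = x :: p ∨ col w, fun w => if w = p ∨ comp w = x :: p then p else comp w,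
    fun w => if w = p then 0 else if comp w = x :: p then pos w + 1 else pos w, ?_⟩
  simp only [nodes, Finset.mem_insert, Finset.mem_union] at *
  constructor <;> try simp only [nodes, Finset.mem_insert, Finset.mem_union, HasLabel]
  · grind
  · grind
  · clear h5 h6 h7 h8 h9 h10 h11 h5' h6' h7' h8' h9' h10' h11' h4 h4' h2 h2'
    rintro w (rfl | hw | hw) ht
    · grind
    · by_cases hw' : w = false :: x :: p <;> grind
    · by_cases hw' : w = true :: x :: p <;> grind
  · have hwl : ∀ w ∈ l.nodes (false :: x :: p), w = false :: x :: p ∨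
        w.tail ∈ l.nodes (false :: x :: p) ∧ w.tail ≠ p ∧ w.tail ≠ x :: p := by grind
    have hwr : ∀ w ∈ r.nodes (true :: x :: p), w = true :: x :: p ∨
        w.tail ∈ r.nodes (true :: x :: p) ∧ w.tail ≠ p ∧ w.tail ≠ x :: p := by grind
    clear h5 h6 h7 h8 h9 h10 h11 h5' h6' h7' h8' h9' h10' h11' h3 h3' h2 h2'
      htaill htailr hlabl hlabr
    rintro v (rfl | hv | hv) w (rfl | hw | hw) hvw ht
    · grind
    · rcases hwl w hw with rfl | hw' <;> grind
    · rcases hwr w hw with rfl | hw' <;> grind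
    · rcases hwl v hv with rfl | hv' <;> grind
    · grind
    · rcases hwl v hv with rfl | hv' <;> rcases hwr w hw with rfl | hw' <;> grind
    · rcases hwr v hv with rfl | hv' <;> grind
    · rcases hwr v hv with rfl | hv' <;> rcases hwl w hw with rfl | hw' <;> grind
    · grind
  · have hwl : ∀ w ∈ l.nodes (false :: x :: p), w = false :: x :: p ∨
        w.tail ∈ l.nodes (false :: x :: p) ∧ w.tail ≠ p ∧ w.tail ≠ x :: p := by grind
    have hwr : ∀ w ∈ r.nodes (true :: x :: p), w = true :: x :: p ∨
        w.tail ∈ r.nodes (true :: x :: p) ∧ w.tail ≠ p ∧ w.tail ≠ x :: p := by grind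
    rintro v (rfl | hv | hv) hc
    · grind
    · have := h5 v hv
      rcases hwl v hv with rfl | hv'
      · clear htaill htailr hlabl hlabr h2 h3 h4 h2' h3' h4' h6 h6' hwl hwr
        simp only [List.tail_cons] at *
        grind
      · clear htaill htailr hlabl hlabr h2 h3 h4 h2' h3' h4' h6 h6' hwl hwr
        grind
    · have := h5' v hv
      rcases hwr v hv with rfl | hv'
      · clear htaill htailr hlabl hlabr h2 h3 h4 h2' h3' h4' h6 h6' hwl hwr
        simp only [List.tail_cons] at *
        grind
      · clear htaill htailr hlabl hlabr h2 h3 h4 h2' h3' h4' h6 h6' hwl hwr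
        grind
  · grind
  · grind
  · grind
  · grind
  · grind
  · grind

theorem Cert.glue {k σ l r i j p col comp pos col' comp' pos'}
    (hl : Cert k σ l i false p col comp pos) (hr : Cert k σ r j true p col' comp' pos') :
    ∃ col comp pos, Cert k σ l i false p col comp pos ∧ Cert k σ r j true p col comp pos := by
  have hd := fun w => @notMem_nodes_of_mem_nodes l r p w _ _ Bool.false_ne_true
  have hal := not_mem_nodes_cons l false p
  have har := not_mem_nodes_cons r true p
  have h1 := hl.comp_root
  have h2 := hr.comp_root
  have h3 := hl.pos_root
  have h4 := hr.pos_root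
  refine ⟨fun w => if w ∈ l.nodes (false :: p) then col w else col' w,
    fun w => if w ∈ l.nodes (false :: p) then comp w else comp' w,
    fun w => if w ∈ l.nodes (false :: p) then pos w else pos' w, hl.congr ?_ ?_ ?_,
    hr.congr ?_ ?_ ?_⟩ <;> grind

theorem State.exists_cert {k σ t n} (hk : 1 ≤ k) (h : State k σ t n) (x : Bool) (p : List Bool) :
    ∃ col comp pos, Cert k σ t n x p col comp pos := by
  induction h generalizing x p with
  | leaf_zero h =>
    refine ⟨fun _ => False, id, fun _ => 0, ?_⟩
    constructor <;> simp_all [nodes, HasLabel]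
  | leaf_one h =>
    refine ⟨fun _ => True, fun _ => p, fun w => if w = p then 0 else 1, ?_⟩
    constructor <;> simp_all [nodes, HasLabel]
  | un_zero h hj ih =>
    obtain ⟨_, _, _, h⟩ := ih false (x :: p)
    exact h.un_zero hj
  | un_succ h hj ih =>
    obtain ⟨_, _, _, h⟩ := ih false (x :: p)
    exact h.un_succ hj
  | bin_zero hl hr hi hj hij ihl ihr =>
    obtain ⟨_, _, _, hl⟩ := ihl false (x :: p)
    obtain ⟨_, _, _, hr⟩ := ihr true (x :: p)
    obtain ⟨_, _, _, hl, hr⟩ := hl.glue hr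
    exact hl.bin_zero hr hi hj hij
  | bin_left hl hr hi hk ihl ihr =>
    obtain ⟨_, _, _, hl⟩ := ihl false (x :: p)
    obtain ⟨_, _, _, hr⟩ := ihr true (x :: p)
    obtain ⟨_, _, _, hl, hr⟩ := hl.glue hr
    exact hl.bin_succ hr (by omega) hk
  | bin_right hl hr hj hk ihl ihr =>
    obtain ⟨_, _, _, hl⟩ := ihl false (x :: p)
    obtain ⟨_, _, _, hr⟩ := ihr true (x :: p)
    obtain ⟨_, _, _, hl, hr⟩ := hl.glue hr
    simpa using hl.bin_succ hr (by omega) (by omega)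

/-- `u` and `v` are joined by an edge of the forest given by `col`. -/
def Link (col : List Bool → Prop) (u v : List Bool) : Prop :=
  (v ≠ [] ∧ u = v.tail ∧ col v) ∨ (u ≠ [] ∧ v = u.tail ∧ col u)

theorem Link.symm {col : List Bool → Prop} {u v : List Bool} (h : Link col u v) :
    Link col v u := Or.symm h

/-- The conditions on `col` implied by a decomposition into a matching and a `k`-bounded linear
forest on the nodes in `N`. -/
structure IsLocal (k : ℕ) (N : Finset (List Bool)) (col : List Bool → Prop) : Prop where
  parent : ∀ w ∈ N, w.tail ∈ N → col w ∨ col w.tail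
  sibling : ∀ v ∈ N, ∀ w ∈ N, v ≠ w → v.tail = w.tail → col v ∨ col w
  degree : ∀ a ∈ N, false :: a ∈ N → true :: a ∈ N →
    ¬ (col a ∧ col (false :: a) ∧ col (true :: a))
  length_le : ∀ L : List (List Bool), L.Nodup → (∀ w ∈ L, w = [] ∨ w ∈ N) →
    L.IsChain (Link col) → L.length ≤ k + 1

theorem IsLocal.exists_state {k N col} (h : IsLocal k N col) (σ : Bool → Prop) (t : BTree)
    (x : Bool) (p : List Bool) (hN : t.nodes (x :: p) ⊆ N) (hp : p = [] ∨ p ∈ N)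
    (hlab : ∀ b w, t.HasLabel b (x :: p) w → (col w ↔ σ b)) :
    ∃ n, State k σ t n ∧ (n ≠ 0 ↔ col (x :: p)) ∧ ∃ L : List (List Bool), L.length = n ∧
      (∀ w ∈ L, w ∈ t.nodes (x :: p)) ∧ L.Nodup ∧ (p :: L).IsChain (Link col) := by
  have hext : ∀ (t : BTree) (x : Bool) (p : List Bool) (L : List (List Bool)),
      (p = [] ∨ p ∈ N) → t.nodes (x :: p) ⊆ N → (∀ w ∈ L, w ∈ t.nodes (x :: p)) → L.Nodup →
      (p :: L).IsChain (Link col) → L.length ≤ k := by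
    intro t x p L hp hN hL hnd hc
    have := h.length_le (p :: L) (List.nodup_cons.2 ⟨fun hpL =>
      not_mem_nodes_cons t x p (hL p hpL), hnd⟩) (by
        intro w hw
        rcases List.mem_cons.1 hw with rfl | hw
        · exact hp
        · exact Or.inr (hN (hL w hw))) hc
    simpa using this
  induction t generalizing x p with
  | leaf o =>
    by_cases hc : col (x :: p)
    · refine ⟨1, .leaf_one fun b hb => (hlab b (x :: p) ⟨hb, rfl⟩).1 hc, by simpa, [x :: p], rfl,
        by simp [nodes], by simp, by simp [Link, hc]⟩
    · refine ⟨0, .leaf_zero fun b hb => mt (hlab b (x :: p) ⟨hb, rfl⟩).2 hc, by simpa, [], rfl,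
        by simp, by simp, by simp⟩
  | un c ih =>
    have hsub : c.nodes (false :: x :: p) ⊆ (un c).nodes (x :: p) := Finset.subset_insert _ _
    have ha := self_mem_nodes (un c) (x :: p)
    obtain ⟨n, hs, hn, L, hL, hLc, hnd, hch⟩ := ih false (x :: p) (hsub.trans hN)
      (Or.inr (hN ha)) hlab
    by_cases hc : col (x :: p)
    · have h1 : ∀ w ∈ (x :: p) :: L, w ∈ (un c).nodes (x :: p) := by
        intro w hw
        rcases List.mem_cons.1 hw with rfl | hw
        · exact ha
        · exact hsub (hLc w hw)
      have h2 : ((x :: p) :: L).Nodup := List.nodup_cons.2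
        ⟨fun hpL => not_mem_nodes_cons c _ _ (hLc _ hpL), hnd⟩
      have h3 : (p :: (x :: p) :: L).IsChain (Link col) :=
        List.isChain_cons_cons.2 ⟨by simp [Link, hc], hch⟩
      have h4 := hext _ _ _ _ hp hN h1 h2 h3
      simp only [List.length_cons, hL] at h4
      exact ⟨n + 1, .un_succ hs h4, by simpa, _, by simp [hL], h1, h2, h3⟩
    · have h1 : col (false :: x :: p) :=
        (h.parent _ (hN (hsub (self_mem_nodes _ _))) (hN ha)).resolve_right hc
      exact ⟨0, .un_zero hs (Nat.one_le_iff_ne_zero.2 (hn.2 h1)), by simpa, [], rfl,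
        by simp, by simp, by simp⟩
  | bin l r ihl ihr =>
    have hsubl : l.nodes (false :: x :: p) ⊆ (bin l r).nodes (x :: p) :=
      Finset.subset_union_left.trans (Finset.subset_insert _ _)
    have hsubr : r.nodes (true :: x :: p) ⊆ (bin l r).nodes (x :: p) :=
      Finset.subset_union_right.trans (Finset.subset_insert _ _)
    have ha := self_mem_nodes (bin l r) (x :: p)
    have hfl := hN (hsubl (self_mem_nodes _ _))
    have htr := hN (hsubr (self_mem_nodes _ _))
    obtain ⟨i, hsl, hil, L, hL, hLc, hndl, hchl⟩ := ihl false (x :: p) (hsubl.trans hN)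
      (Or.inr (hN ha)) fun b w hw => hlab b w (Or.inl hw)
    obtain ⟨j, hsr, hjr, R, hR, hRc, hndr, hchr⟩ := ihr true (x :: p) (hsubr.trans hN)
      (Or.inr (hN ha)) fun b w hw => hlab b w (Or.inr hw)
    have hsib := h.sibling _ hfl _ htr (by simp) (by simp)
    by_cases hc : col (x :: p)
    · have key : ∀ (c : BTree) (y : Bool) (n : ℕ) (L : List (List Bool)),
          c.nodes (y :: x :: p) ⊆ (bin l r).nodes (x :: p) → L.length = n →
          (∀ w ∈ L, w ∈ c.nodes (y :: x :: p)) → L.Nodup → ((x :: p) :: L).IsChain (Link col) →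
          n + 1 ≤ k ∧ ∃ L : List (List Bool), L.length = n + 1 ∧
            (∀ w ∈ L, w ∈ (bin l r).nodes (x :: p)) ∧ L.Nodup ∧ (p :: L).IsChain (Link col) := by
        intro c y n L hsub hL hLc hnd hch
        have h1 : ∀ w ∈ (x :: p) :: L, w ∈ (bin l r).nodes (x :: p) := by
          intro w hw
          rcases List.mem_cons.1 hw with rfl | hw
          · exact ha
          · exact hsub (hLc w hw)
        have h2 : ((x :: p) :: L).Nodup := List.nodup_cons.2
          ⟨fun hpL => not_mem_nodes_cons c _ _ (hLc _ hpL), hnd⟩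
        have h3 : (p :: (x :: p) :: L).IsChain (Link col) :=
          List.isChain_cons_cons.2 ⟨by simp [Link, hc], hch⟩
        have h4 := hext _ _ _ _ hp hN h1 h2 h3
        simp only [List.length_cons, hL] at h4
        exact ⟨h4, _, by simp [hL], h1, h2, h3⟩
      by_cases hl : col (false :: x :: p)
      · have hr : j = 0 := by
          by_contra hj
          exact h.degree _ (hN ha) hfl htr ⟨hc, hl, hjr.1 hj⟩
        subst hr
        obtain ⟨h4, h5⟩ := key l false i L hsubl hL hLc hndl hchl
        exact ⟨i + 1, .bin_left hsl hsr (Nat.one_le_iff_ne_zero.2 (hil.2 hl)) h4, by simpa, h5⟩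
      · have hi : i = 0 := by
          by_contra hi
          exact hl (hil.1 hi)
        subst hi
        obtain ⟨h4, h5⟩ := key r true j R hsubr hR hRc hndr hchr
        exact ⟨j + 1, .bin_right hsl hsr
          (Nat.one_le_iff_ne_zero.2 (hjr.2 (hsib.resolve_left hl))) h4, by simpa, h5⟩
    · have hl := (h.parent _ hfl (hN ha)).resolve_right hc
      have hr := (h.parent _ htr (hN ha)).resolve_right hc
      have hlen := h.length_le (L.reverse ++ (x :: p) :: R) (by
          rw [List.nodup_append]
          refine ⟨List.nodup_reverse.2 hndl, List.nodup_cons.2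
            ⟨fun hpR => not_mem_nodes_cons r _ _ (hRc _ hpR), hndr⟩, ?_⟩
          rintro u hu v hv rfl
          rw [List.mem_reverse] at hu
          rcases List.mem_cons.1 hv with rfl | hv
          · exact not_mem_nodes_cons l _ _ (hLc _ hu)
          · exact notMem_nodes_of_mem_nodes Bool.false_ne_true (hLc _ hu) (hRc _ hv)) (by
          intro w hw
          simp only [List.mem_append, List.mem_reverse, List.mem_cons] at hw
          rcases hw with hw | rfl | hw
          · exact Or.inr (hN (hsubl (hLc w hw)))
          · exact Or.inr (hN ha)
          · exact Or.inr (hN (hsubr (hRc w hw)))) (by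
          rw [List.isChain_split]
          refine ⟨?_, hchr⟩
          rw [← List.reverse_cons, List.isChain_reverse]
          exact hchl.imp fun _ _ => Link.symm)
      simp only [List.length_append, List.length_reverse, List.length_cons, hL, hR] at hlen
      exact ⟨0, .bin_zero hsl hsr (Nat.one_le_iff_ne_zero.2 (hil.2 hl))
        (Nat.one_le_iff_ne_zero.2 (hjr.2 hr)) (by omega), by simpa, [], rfl,
        by simp, by simp, by simp⟩

theorem state_leaf_iff {k σ o n} : State k σ (leaf o) n ↔
    (n = 0 ∧ ∀ b, o = some b → ¬ σ b) ∨ (n = 1 ∧ ∀ b, o = some b → σ b) := by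
  constructor
  · rintro (h | h)
    · exact .inl ⟨rfl, h⟩
    · exact .inr ⟨rfl, h⟩
  · rintro (⟨rfl, h⟩ | ⟨rfl, h⟩)
    · exact .leaf_zero h
    · exact .leaf_one h

theorem state_un_iff {k σ c n} : State k σ (un c) n ↔
    ∃ j, State k σ c j ∧ (n = 0 ∧ 1 ≤ j ∨ n = j + 1 ∧ j + 1 ≤ k) := by
  constructor
  · intro h
    cases h with
    | un_zero h hj => exact ⟨_, h, .inl ⟨rfl, hj⟩⟩
    | un_succ h hj => exact ⟨_, h, .inr ⟨rfl, hj⟩⟩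
  · rintro ⟨j, h, ⟨rfl, hj⟩ | ⟨rfl, hj⟩⟩
    · exact .un_zero h hj
    · exact .un_succ h hj

theorem state_bin_iff {k σ l r n} : State k σ (bin l r) n ↔
    ∃ i, State k σ l i ∧ ∃ j, State k σ r j ∧ (n = 0 ∧ 1 ≤ i ∧ 1 ≤ j ∧ i + j ≤ k ∨
      n = i + j + 1 ∧ n ≤ k ∧ (i = 0 ∧ 1 ≤ j ∨ 1 ≤ i ∧ j = 0)) := by
  constructor
  · intro h
    cases h with
    | bin_zero hl hr => exact ⟨_, hl, _, hr, by omega⟩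
    | bin_left hl hr => exact ⟨_, hl, _, hr, by omega⟩
    | bin_right hl hr => exact ⟨_, hl, _, hr, by omega⟩
  · rintro ⟨i, hl, j, hr, ⟨rfl, hi, hj, hk⟩ | ⟨rfl, hk, ⟨rfl, hj⟩ | ⟨hi, rfl⟩⟩⟩
    · exact .bin_zero hl hr hi hj hk
    · simpa using State.bin_right hl hr hj (by omega)
    · exact .bin_left hl hr hi hk

/-- The complete binary tree of height `i`. -/
def full : ℕ → BTree
  | 0 => leaf none
  | i + 1 => bin (full i) (full i)

/-- A path with complete binary trees attached, whose only state is `h + 2 + i` for suitable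
parameters. -/
def spine (h : ℕ) : ℕ → BTree
  | 0 => bin (full h) (full h)
  | i + 1 => bin (spine h i) (full h)

/-- A tree whose only state is `0`. -/
def cap (k : ℕ) : BTree := un (spine (k / 2) (k - k / 2 - 2))

/-- A path of length `i` above `t`, with a copy of `c` attached to each vertex. -/
def cappedPath (c : BTree) : ℕ → BTree → BTree
  | 0, t => t
  | i + 1, t => bin c (cappedPath c i t)

theorem state_full_iff {k σ i n} (hi : 2 * i ≤ k) (hk : 1 ≤ k) :
    State k σ (full i) n ↔ n = 0 ∨ n = i + 1 := by
  induction i generalizing n with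
  | zero => simp [full, state_leaf_iff]
  | succ i ih =>
    simp only [full, state_bin_iff, ih (by omega)]
    constructor
    · rintro ⟨i, hi, j, hj, h⟩; omega
    · rintro (rfl | rfl)
      · exact ⟨i + 1, .inr rfl, i + 1, .inr rfl, by omega⟩
      · exact ⟨i + 1, .inr rfl, 0, .inl rfl, by omega⟩

theorem state_spine_iff {k σ i n} (hi : k / 2 + 2 + i ≤ k) :
    State k σ (spine (k / 2) i) n ↔ n = k / 2 + 2 + i := by
  have hf : ∀ {n}, State k σ (full (k / 2)) n ↔ n = 0 ∨ n = k / 2 + 1 :=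
    state_full_iff (by omega) (by omega)
  induction i generalizing n with
  | zero =>
    simp only [spine, state_bin_iff, hf]
    constructor
    · rintro ⟨i, hi, j, hj, h⟩; omega
    · rintro rfl
      exact ⟨k / 2 + 1, .inr rfl, 0, .inl rfl, by omega⟩
  | succ i ih =>
    simp only [spine, state_bin_iff, hf, ih (by omega)]
    constructor
    · rintro ⟨i, hi, j, hj, h⟩; omega
    · rintro rfl
      exact ⟨_, rfl, 0, .inl rfl, by omega⟩

theorem state_cap_iff {k σ n} (hk : 3 ≤ k) : State k σ (cap k) n ↔ n = 0 := by
  simp only [cap, state_un_iff, state_spine_iff (show k / 2 + 2 + (k - k / 2 - 2) ≤ k by omega)]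
  constructor
  · rintro ⟨j, hj, h⟩; omega
  · rintro rfl
    exact ⟨_, rfl, by omega⟩

theorem state_cappedPath_iff {k σ i t n} (hk : 3 ≤ k) :
    State k σ (cappedPath (cap k) i t) n ↔
      ∃ j, State k σ t j ∧ n = j + i ∧ (i = 0 ∨ 1 ≤ j ∧ j + i ≤ k) := by
  induction i generalizing n with
  | zero => simp [cappedPath]
  | succ i ih =>
    simp only [cappedPath, state_bin_iff, state_cap_iff hk, ih]
    constructor
    · rintro ⟨_, rfl, m, ⟨j, hj, h⟩, h'⟩
      exact ⟨j, hj, by omega⟩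
    · rintro ⟨j, hj, h⟩
      exact ⟨_, rfl, j + i, ⟨j, hj, by omega⟩, by omega⟩

/-- A tree whose only state is `i + 1`. -/
def pendantPath (k i : ℕ) : BTree := cappedPath (cap k) i (un (cap k))

theorem state_pendantPath_iff {k σ i n} (hk : 3 ≤ k) (hi : i + 1 ≤ k) :
    State k σ (pendantPath k i) n ↔ n = i + 1 := by
  simp only [pendantPath, state_cappedPath_iff hk, state_un_iff, state_cap_iff hk]
  constructor
  · rintro ⟨j, ⟨_, rfl, h⟩, h'⟩; omega
  · rintro rfl
    exact ⟨1, ⟨0, rfl, by omega⟩, by omega⟩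

/-- The tree of the variable gadget; the labelled leaves are the positive inputs, and the edge above
the top node is the negative input edge. -/
def gadget (k : ℕ) : BTree :=
  un (bin (pendantPath k (k - 2)) (un (bin (bin (pendantPath k (k - 3)) (leaf (some false)))
    (un (un (un (cappedPath (cap k) (k - 2) (un (leaf (some true))))))))))

theorem State.gadget_conflict {k σ n} (hk : 3 ≤ k) (h : State k σ (gadget k) n) (hn : n ≠ 0) :
    ¬ σ false ∧ ¬ σ true := by
  simp only [gadget, state_un_iff, state_bin_iff, state_cappedPath_iff hk, state_leaf_iff,
    state_pendantPath_iff hk (show k - 2 + 1 ≤ k by omega),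
    state_pendantPath_iff hk (show k - 3 + 1 ≤ k by omega), Option.some.injEq, forall_eq'] at h
  obtain ⟨g, ⟨_, rfl, f, ⟨s, ⟨r₁, ⟨_, rfl, x, hx, h₁⟩, r₂, ⟨w, ⟨z, ⟨q, ⟨m, ⟨y, hy, h₂⟩, h₃⟩,
    h₄⟩, h₅⟩, h₆⟩, h₇⟩, h₈⟩, h₉⟩, h₁₀⟩ := h
  have hx0 : x = 0 := by omega
  have hy0 : y = 0 := by omega
  constructor
  · rcases hx with hx | hx
    · exact hx.2
    · omega
  · rcases hy with hy | hy
    · exact hy.2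
    · omega

theorem exists_state_gadget {k : ℕ} (hk : 3 ≤ k) (σ : Bool → Prop) (P : Prop)
    (hP : P → ¬ σ false ∧ ¬ σ true) : ∃ n, State k σ (gadget k) n ∧ (n ≠ 0 ↔ P) := by
  simp only [gadget, state_un_iff, state_bin_iff, state_cappedPath_iff hk, state_leaf_iff,
    state_pendantPath_iff hk (show k - 2 + 1 ≤ k by omega),
    state_pendantPath_iff hk (show k - 3 + 1 ≤ k by omega), Option.some.injEq, forall_eq']
  obtain ⟨y, hy, m, hm, hm'⟩ : ∃ y, (y = 0 ∧ ¬ σ true ∨ y = 1 ∧ σ true) ∧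
      ∃ m, m = y + 1 ∧ m ≤ 2 := by
    by_cases h : σ true
    · exact ⟨1, .inr ⟨rfl, h⟩, 2, by simp⟩
    · exact ⟨0, .inl ⟨rfl, h⟩, 1, by simp⟩
  by_cases h : P
  · obtain ⟨h₁, h₂⟩ := hP h
    refine ⟨1, ⟨0, ⟨_, rfl, 1, ⟨0, ⟨k - 1, ⟨_, rfl, 0, .inl ⟨rfl, h₁⟩, by omega⟩, 1,
      ⟨0, ⟨k, ⟨k - 1, ⟨1, ⟨0, .inl ⟨rfl, h₂⟩, by omega⟩, by omega⟩, by omega⟩, by omega⟩,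
      by omega⟩, by omega⟩, by omega⟩, by omega⟩, by omega⟩, by simpa⟩
  · by_cases h₁ : σ false
    · exact ⟨0, ⟨k, ⟨_, rfl, 0, ⟨3, ⟨0, ⟨_, rfl, 1, .inr ⟨rfl, h₁⟩, by omega⟩, 2,
        ⟨1, ⟨0, ⟨m + (k - 2), ⟨m, ⟨y, hy, by omega⟩, by omega⟩, by omega⟩, by omega⟩, by omega⟩,
        by omega⟩, by omega⟩, by omega⟩, by omega⟩, by simpa⟩
    · exact ⟨0, ⟨k, ⟨_, rfl, 0, ⟨k, ⟨k - 1, ⟨_, rfl, 0, .inl ⟨rfl, h₁⟩, by omega⟩, 0,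
        ⟨1, ⟨0, ⟨m + (k - 2), ⟨m, ⟨y, hy, by omega⟩, by omega⟩, by omega⟩, by omega⟩, by omega⟩,
        by omega⟩, by omega⟩, by omega⟩, by omega⟩, by simpa⟩

theorem not_hasLabel_full (b : Bool) (i : ℕ) (a w : List Bool) : ¬ (full i).HasLabel b a w := by
  induction i generalizing a with
  | zero => simp [full, HasLabel]
  | succ i ih => simp [full, HasLabel, ih]

theorem not_hasLabel_spine (b : Bool) (h i : ℕ) (a w : List Bool) :
    ¬ (spine h i).HasLabel b a w := by
  induction i generalizing a with
  | zero => simp [spine, HasLabel, not_hasLabel_full]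
  | succ i ih => simp [spine, HasLabel, ih, not_hasLabel_full]

theorem not_hasLabel_cap (b : Bool) (k : ℕ) (a w : List Bool) : ¬ (cap k).HasLabel b a w :=
  not_hasLabel_spine _ _ _ _ _

theorem hasLabel_cappedPath_iff {b : Bool} {k i : ℕ} {t : BTree} {a w : List Bool} :
    (cappedPath (cap k) i t).HasLabel b a w ↔ t.HasLabel b (List.replicate i true ++ a) w := by
  induction i generalizing a with
  | zero => simp [cappedPath]
  | succ i ih =>
    simp [cappedPath, HasLabel, ih, not_hasLabel_cap, List.replicate_succ']

theorem exists_label_gadget (k : ℕ) : ∃ ℓ : Bool → List Bool,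
    (∀ b w, (gadget k).HasLabel b [false] w ↔ w = ℓ b) ∧ ℓ false ≠ ℓ true ∧
      (∀ b, ℓ b ≠ []) ∧ ∀ b, ℓ b ≠ [false] := by
  refine ⟨fun b => if b then false :: (List.replicate (k - 2) true ++
    [false, false, false, true, false, true, false, false]) else
      [true, false, false, true, false, false], ?_, by simp, by simp, by simp⟩
  rintro (_ | _) w <;>
    simp [gadget, HasLabel, pendantPath, hasLabel_cappedPath_iff, not_hasLabel_cap]

/-- The vertices of the graph of `t`: its nodes and the vertex `[]` above the top node. -/
abbrev Vertex (t : BTree) : Type := {w : List Bool // w ∈ insert [] (t.nodes [false])}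

variable {t : BTree}

theorem Vertex.mem_nodes (v : t.Vertex) (hv : v.1 ≠ []) : v.1 ∈ t.nodes [false] :=
  (Finset.mem_insert.1 v.2).resolve_left hv

/-- The parent of a vertex. -/
def Vertex.par (v : t.Vertex) : t.Vertex := ⟨v.1.tail, by
  by_cases h : v.1 = []
  · simp [h]
  by_cases h' : v.1 = [false]
  · simp [h']
  · exact Finset.mem_insert_of_mem (tail_mem_nodes (v.mem_nodes h) h')⟩

/-- The edge joining a vertex to its parent. -/
def Vertex.up (v : t.Vertex) : Sym2 t.Vertex := s(v, v.par)

theorem Vertex.par_ne (v : t.Vertex) (hv : v.1 ≠ []) : v ≠ v.par := fun h => by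
  have h1 := congrArg (fun u : t.Vertex => u.1.length) h
  have h2 := List.length_pos_iff.2 hv
  simp [Vertex.par] at h1
  omega

theorem Vertex.eq_of_par_eq {v w : t.Vertex} (hv : v.1 ≠ []) (h : v.par = w) :
    ∃ b, v.1 = b :: w.1 := by
  subst h
  exact ⟨v.1.head hv, by simp [Vertex.par]⟩

theorem Vertex.up_injOn : Set.InjOn (Vertex.up (t := t)) {v | v.1 ≠ []} := by
  intro v hv w hw h
  rcases Sym2.eq_iff.1 h with h | h
  · exact h.1
  · obtain ⟨b, hb⟩ := Vertex.eq_of_par_eq hv h.2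
    obtain ⟨c, hc⟩ := Vertex.eq_of_par_eq hw h.1.symm
    rw [hc] at hb
    exact absurd (congrArg List.length hb) (by simp; omega)

/-- The graph of `t`, including the pendant edge above the top node. -/
def graph (t : BTree) : SimpleGraph t.Vertex := fromEdgeSet (Vertex.up '' {v | v.1 ≠ []})

theorem edgeSet_graph : t.graph.edgeSet = Vertex.up '' {v | v.1 ≠ []} := by
  rw [graph, edgeSet_fromEdgeSet, sdiff_eq_left, Set.disjoint_left]
  rintro _ ⟨v, hv, rfl⟩ h
  exact v.par_ne hv (by simpa [Vertex.up] using h)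

theorem Cert.isMLFDecomp {k σ n col comp pos} (h : Cert k σ t n false [] col comp pos) :
    IsMLFDecomp t.graph k (Vertex.up '' {v | v.1 ≠ [] ∧ col v.1})
      (Vertex.up '' {v | v.1 ≠ [] ∧ ¬ col v.1}) := by
  refine ⟨?_, ?_, ?_, ?_, ?_⟩
  · rw [edgeSet_graph, ← Set.image_union]
    congr 1
    ext v
    simp only [Set.mem_union, Set.mem_ofPred_eq]
    tauto
  · rw [Set.disjoint_left]
    rintro _ ⟨v, hv, rfl⟩ ⟨w, hw, hvw⟩
    rw [Vertex.up_injOn hw.1 hv.1 hvw] at hw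
    exact hw.2 hv.2
  · refine isBddLinearForestIn_of_cert ?_ (fun v => comp v.1) (fun v => pos v.1) ?_ ?_ ?_
    · rw [edgeSet_graph]
      exact Set.image_mono fun v hv => hv.1
    · rintro u w ⟨v, hv, hvw⟩
      have h1 := h.step v.1 (v.mem_nodes hv.1) hv.2
      rcases Sym2.eq_iff.1 hvw with ⟨rfl, rfl⟩ | ⟨rfl, rfl⟩
      · exact h1
      · exact ⟨h1.1.symm, h1.2.symm⟩
    · intro u v h1 h2
      exact Subtype.ext (h.inj u.1 u.2 v.1 v.2 h1 h2)
    · intro v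
      by_cases hv : v.1 = []
      · simp [hv, h.pos_root]
      · exact h.pos_le v.1 (v.mem_nodes hv)
  · rw [edgeSet_graph]
    exact Set.image_mono fun v hv => hv.1
  · rintro _ ⟨v, ⟨hv, hcv⟩, rfl⟩ _ ⟨w, ⟨hw, hcw⟩, rfl⟩ hne u hu hu'
    have hvw : v ≠ w := fun h => hne (h ▸ rfl)
    have key : ∀ {v w : t.Vertex}, v.1 ≠ [] → w.1 ≠ [] → ¬ col v.1 → ¬ col w.1 → v ≠ w.par := by
      rintro v w hv hw hcv hcw rfl
      exact (h.parent w.1 (w.mem_nodes hw) (Vertex.mem_nodes _ hv)).elim hcw hcv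
    rcases Sym2.mem_iff.1 hu with rfl | rfl <;> rcases Sym2.mem_iff.1 hu' with h' | h'
    · exact hvw h'
    · exact key hv hw hcv hcw h'
    · exact key hw hv hcw hcv h'.symm
    · exact (h.sibling v.1 (v.mem_nodes hv) w.1 (w.mem_nodes hw) (fun h => hvw (Subtype.ext h))
        (congrArg Subtype.val h')).elim hcv hcw

theorem isLocal_of_isMLFDecomp {k F M} (h : IsMLFDecomp t.graph k F M) :
    IsLocal k (t.nodes [false]) fun w => ∃ v : t.Vertex, v.1 = w ∧ w ≠ [] ∧ v.up ∈ F := by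
  obtain ⟨hU, -, ⟨-, -, hdeg, hlen⟩, -, hM⟩ := h
  have hne : ∀ w ∈ t.nodes [false], w ≠ [] := by
    rintro w hw rfl
    simpa using suffix_of_mem_nodes hw
  have hmem : ∀ v : t.Vertex, v.1 ≠ [] → v.up ∉ F → v.up ∈ M := by
    intro v hv hF
    have : v.up ∈ F ∪ M := by
      rw [hU, edgeSet_graph]
      exact ⟨v, hv, rfl⟩
    exact this.resolve_left hF
  have hmeet : ∀ v w : t.Vertex, v.1 ≠ [] → w.1 ≠ [] → v ≠ w → ∀ u, u ∈ v.up → u ∈ w.up →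
      v.up ∈ F ∨ w.up ∈ F := by
    intro v w hv hw hvw u hu hu'
    by_contra! hF
    exact hM _ (hmem v hv hF.1) _ (hmem w hw hF.2) (fun h => hvw (Vertex.up_injOn hv hw h)) u hu hu'
  constructor
  · intro w hw hw'
    let v : t.Vertex := ⟨w, Finset.mem_insert_of_mem hw⟩
    have h1 := hne _ hw
    have h2 := hne _ hw'
    exact (hmeet v v.par h1 h2 (v.par_ne h1) v.par (by simp [Vertex.up]) (by simp [Vertex.up])).imp
      (fun h => ⟨v, rfl, h1, h⟩) (fun h => ⟨v.par, rfl, h2, h⟩)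
  · intro v hv w hw hvw ht
    let v' : t.Vertex := ⟨v, Finset.mem_insert_of_mem hv⟩
    let w' : t.Vertex := ⟨w, Finset.mem_insert_of_mem hw⟩
    have h1 := hne _ hv
    have h2 := hne _ hw
    have h3 : v'.par = w'.par := Subtype.ext ht
    exact (hmeet v' w' h1 h2 (fun h => hvw (congrArg Subtype.val h)) v'.par (by simp [Vertex.up])
      (by simp [Vertex.up, h3])).imp (fun h => ⟨v', rfl, h1, h⟩) (fun h => ⟨w', rfl, h2, h⟩)
  · rintro a ha hl hr ⟨⟨v, rfl, hv, hvF⟩, ⟨x, hx, hx', hxF⟩, ⟨y, hy, hy', hyF⟩⟩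
    have hxv : x.par = v := Subtype.ext (by simp [Vertex.par, hx])
    have hyv : y.par = v := Subtype.ext (by simp [Vertex.par, hy])
    have hxy : x ≠ y := fun h => by simp [← h, hx] at hy
    have hx0 : x.1 ≠ [] := by simp [hx]
    have hy0 : y.1 ≠ [] := by simp [hy]
    have hle := hdeg v
    have hsub : ({v.up, x.up, y.up} : Set (Sym2 t.Vertex)) ⊆ {e ∈ F | v ∈ e} := by
      rintro e (rfl | rfl | rfl)
      · exact ⟨hvF, by simp [Vertex.up]⟩
      · exact ⟨hxF, by simp [Vertex.up, hxv]⟩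
      · exact ⟨hyF, by simp [Vertex.up, hyv]⟩
    have h3 : ({v.up, x.up, y.up} : Set (Sym2 t.Vertex)).ncard = 3 := by
      refine Set.ncard_eq_three.2 ⟨_, _, _, fun h => ?_, fun h => ?_, fun h => ?_, rfl⟩
      · exact x.par_ne hx0 (hxv.trans (Vertex.up_injOn hv hx0 h)).symm
      · exact y.par_ne hy0 (hyv.trans (Vertex.up_injOn hv hy0 h)).symm
      · exact hxy (Vertex.up_injOn hx0 hy0 h)
    have := Set.ncard_le_ncard hsub (Set.toFinite _)
    omega
  · intro L hnd hL hch
    have hL' : ∀ w ∈ L, w ∈ insert [] (t.nodes [false]) := fun w hw => Finset.mem_insert.2 (hL w hw)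
    lift L to List t.Vertex using hL'
    have hadj : ∀ u v : t.Vertex,
        Link (fun w => ∃ v : t.Vertex, v.1 = w ∧ w ≠ [] ∧ v.up ∈ F) u.1 v.1 →
        (fromEdgeSet F).Adj u v := by
      have key : ∀ u v : t.Vertex, v.1 ≠ [] → u.1 = v.1.tail →
          (∃ w : t.Vertex, w.1 = v.1 ∧ v.1 ≠ [] ∧ w.up ∈ F) → (fromEdgeSet F).Adj v u := by
        rintro u v hv huv ⟨w, hw, -, hF⟩
        obtain rfl := Subtype.ext hw
        obtain rfl : u = w.par := Subtype.ext huv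
        exact (fromEdgeSet_adj _).2 ⟨hF, w.par_ne hv⟩
      rintro u v (⟨h1, h2, h3⟩ | ⟨h1, h2, h3⟩)
      · exact (key u v h1 h2 h3).symm
      · exact key v u h1 h2 h3
    cases L with
    | nil => simp
    | cons x L =>
      rw [List.isChain_map] at hch
      obtain ⟨y, p, hp⟩ := exists_walk_of_isChain x L (hch.imp fun u v h => hadj u v h)
      have h1 := hlen x y p ((Walk.isPath_def _).2 (hp ▸ hnd.of_map _))
      have h2 := congrArg List.length hp
      simp only [Walk.length_support, List.length_cons] at h2
      simp only [List.length_map, List.length_cons]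
      omega

end BTree

end MLFTree

open MLFTree BTree in
/-- For every integer `k ≥ 3` there exists a variable gadget: a finite simple
graph `H` with three distinct degree-1 vertices `p₁, p₂, n`, with unique incident edges
`e₁, e₂, e` respectively, such that (i) every partition `(F̃, M̃)` of `{e₁, e₂, e}` with
neither `{e₁, e}` nor `{e₂, e}` contained in `F̃` extends to a decomposition of `H` into a
`k`-bounded linear forest and a matching, and (ii) in every such decomposition `(F, M)` of `H`,
neither `{e₁, e}` nor `{e₂, e}` is contained in `F`. -/
theorem variableGadget_exists (k : ℕ) (hk : 3 ≤ k) :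
    ∃ (V : Type) (_ : Fintype V) (H : SimpleGraph V) (p₁ p₂ n : V) (e₁ e₂ e : Sym2 V),
      p₁ ≠ p₂ ∧ p₁ ≠ n ∧ p₂ ≠ n ∧
      e₁ ≠ e₂ ∧ e₁ ≠ e ∧ e₂ ≠ e ∧
      (e₁ ∈ H.edgeSet ∧ p₁ ∈ e₁ ∧ ∀ g ∈ H.edgeSet, p₁ ∈ g → g = e₁) ∧
      (e₂ ∈ H.edgeSet ∧ p₂ ∈ e₂ ∧ ∀ g ∈ H.edgeSet, p₂ ∈ g → g = e₂) ∧
      (e ∈ H.edgeSet ∧ n ∈ e ∧ ∀ g ∈ H.edgeSet, n ∈ g → g = e) ∧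
      (∀ Ft Mt : Set (Sym2 V), Ft ∪ Mt = {e₁, e₂, e} → Disjoint Ft Mt →
        ¬ ({e₁, e} : Set (Sym2 V)) ⊆ Ft → ¬ ({e₂, e} : Set (Sym2 V)) ⊆ Ft →
        ∃ F M : Set (Sym2 V), IsMLFDecomp H k F M ∧ Ft ⊆ F ∧ Mt ⊆ M) ∧
      (∀ F M : Set (Sym2 V), IsMLFDecomp H k F M →
        ¬ ({e₁, e} : Set (Sym2 V)) ⊆ F ∧ ¬ ({e₂, e} : Set (Sym2 V)) ⊆ F) := by
  obtain ⟨ℓ, hℓ, hne, hnil, hroot⟩ := exists_label_gadget k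
  have hlab : ∀ b, (gadget k).HasLabel b [false] (ℓ b) := fun b => (hℓ b _).2 rfl
  let p : Bool → (gadget k).Vertex := fun b => ⟨ℓ b, Finset.mem_insert_of_mem (hlab b).mem_nodes⟩
  let r : (gadget k).Vertex := ⟨[false], Finset.mem_insert_of_mem (self_mem_nodes _ _)⟩
  let n : (gadget k).Vertex := ⟨[], Finset.mem_insert_self _ _⟩
  have hr : r.1 ≠ [] := by simp [r]
  have hpr : ∀ b, (p b).up ≠ r.up := fun b h =>
    hroot b (congrArg Subtype.val (Vertex.up_injOn (hnil b) hr h))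
  have hpp : (p false).up ≠ (p true).up := fun h =>
    hne (congrArg Subtype.val (Vertex.up_injOn (hnil _) (hnil _) h))
  have hpend : ∀ b, (p b).up ∈ (gadget k).graph.edgeSet ∧ p b ∈ (p b).up ∧
      ∀ g ∈ (gadget k).graph.edgeSet, p b ∈ g → g = (p b).up := by
    intro b
    rw [edgeSet_graph]
    refine ⟨⟨p b, hnil b, rfl⟩, by simp [Vertex.up], ?_⟩
    rintro _ ⟨v, hv, rfl⟩ h
    rcases Sym2.mem_iff.1 h with h | h
    · rw [h]
    · obtain ⟨x, hx⟩ := Vertex.eq_of_par_eq hv h.symm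
      exact absurd (hx ▸ v.mem_nodes hv) ((hlab b).cons_notMem_nodes x)
  refine ⟨(gadget k).Vertex, inferInstance, (gadget k).graph, p false, p true, n,
    (p false).up, (p true).up, r.up, fun h => hne (congrArg Subtype.val h),
    fun h => hnil _ (congrArg Subtype.val h), fun h => hnil _ (congrArg Subtype.val h),
    hpp, hpr _, hpr _, hpend _, hpend _, ⟨?_, ?_, ?_⟩, ?_, ?_⟩
  · rw [edgeSet_graph]
    exact ⟨r, hr, rfl⟩
  · simp [Vertex.up, Vertex.par, n, r]
  · rw [edgeSet_graph]
    rintro _ ⟨v, hv, rfl⟩ h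
    rcases Sym2.mem_iff.1 h with rfl | h
    · exact absurd rfl hv
    · obtain ⟨x, hx⟩ := Vertex.eq_of_par_eq hv h.symm
      have h1 := suffix_of_mem_nodes (v.mem_nodes hv)
      have h2 := h1.eq_of_length (by simp [hx, n])
      rw [show v = r from Subtype.ext h2.symm]
  · intro Ft Mt hU hd h₁ h₂
    obtain ⟨m, hm, hme⟩ := exists_state_gadget hk (fun b => (p b).up ∈ Ft) (r.up ∈ Ft) (fun he =>
      ⟨fun h => h₁ (by rintro _ (rfl | rfl) <;> assumption),
        fun h => h₂ (by rintro _ (rfl | rfl) <;> assumption)⟩)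
    obtain ⟨col, comp, pos, hc⟩ := hm.exists_cert (by omega) false []
    have hcp : ∀ b, col (p b).1 ↔ (p b).up ∈ Ft := fun b => hc.label b _ (hlab b)
    have hcr : col r.1 ↔ r.up ∈ Ft := hc.top.trans hme
    have hcases : ∀ x ∈ Ft ∪ Mt, ∃ v : (gadget k).Vertex, v.1 ≠ [] ∧ v.up = x ∧
        (col v.1 ↔ v.up ∈ Ft) := by
      rw [hU]
      rintro _ (rfl | rfl | rfl)
      · exact ⟨_, hnil _, rfl, hcp _⟩
      · exact ⟨_, hnil _, rfl, hcp _⟩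
      · exact ⟨_, hr, rfl, hcr⟩
    refine ⟨_, _, hc.isMLFDecomp, fun x hx => ?_, fun x hx => ?_⟩
    · obtain ⟨v, hv, rfl, hcv⟩ := hcases x (.inl hx)
      exact ⟨v, ⟨hv, hcv.2 hx⟩, rfl⟩
    · obtain ⟨v, hv, rfl, hcv⟩ := hcases x (.inr hx)
      exact ⟨v, ⟨hv, fun h => Set.disjoint_left.1 hd (hcv.1 h) hx⟩, rfl⟩
  · intro F M hFM
    have hcol : ∀ v : (gadget k).Vertex, v.1 ≠ [] →
        ((∃ u : (gadget k).Vertex, u.1 = v.1 ∧ v.1 ≠ [] ∧ u.up ∈ F) ↔ v.up ∈ F) := by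
      intro v hv
      refine ⟨?_, fun h => ⟨v, rfl, hv, h⟩⟩
      rintro ⟨u, hu, -, hF⟩
      rwa [← Subtype.ext hu]
    obtain ⟨m, hm, hme, -⟩ := (isLocal_of_isMLFDecomp hFM).exists_state
      (fun b => (p b).up ∈ F) (gadget k) false [] (Finset.Subset.refl _) (.inl rfl) (by
        intro b w hw
        obtain rfl := (hℓ b w).1 hw
        exact hcol (p b) (hnil b))
    have hconf : r.up ∈ F → (p false).up ∉ F ∧ (p true).up ∉ F := fun h =>
      hm.gadget_conflict hk (hme.2 ((hcol r hr).2 h))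
    exact ⟨fun h => (hconf (h (by simp))).1 (h (by simp)),
      fun h => (hconf (h (by simp))).2 (h (by simp))⟩
end

section
/- Let k ≥ 2 be an integer and let G be a finite simple graph whose maximum degree is at most k + 1. Let X₍≥3₎, X₂ and X₁ denote the sets of vertices of G of degree at least 3, of degree exactly 2, and of degree exactly 1, respectively, and let X₍≥k+1₎ denote the set of vertices of degree at least k + 1. Let 𝒫 be the family consisting of all paths in G with both endpoints in X₍≥3₎ ∪ X₁ and all interior vertices in X₂, together with all cycles in G containing at most one vertex of X₍≥3₎; for ℓ ≥ 1 let 𝒫_ℓ ⊆ 𝒫 be the members of 𝒫 with exactly ℓ edges. Let H be the bipartite graph with vertex classes X = X₍≥3₎ and Y = { y_P : P ∈ 𝒫 }, where x ∈ X is joined to y_P exactly when x is an endpoint of P in G. Assign to each vertex v of H a set A_v ⊆ ℕ as follows: A_x = {1} for x ∈ X₍≥k+1₎; A_x = {0,1} for x ∈ X \ X₍≥k+1₎; A_{y_P} = {2} for P ∈ 𝒫₁; A_{y_P} = {1} for P ∈ 𝒫₂; A_{y_P} = {0,2} for P ∈ 𝒫₃; A_{y_P} = {1,2} for P ∈ 𝒫₄;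 and A_{y_P} = {0,1,2} for all other P ∈ 𝒫. If there exists a set S ⊆ E(H) such that the degree of every vertex v of H in the subgraph spanned by S belongs to A_v, then the edge set of G admits a partition into a matching and a k-bounded star forest. -/
/-- `S` is a `k`-bounded star forest in `G`: a set of edges of `G` spanning a vertex-disjoint
union of stars, each with at most `k` edges.  Equivalently (for a finite graph): every edge of
`S` has an endpoint incident to exactly one edge of `S`, and every vertex is incident to at
most `k` edges of `S`. -/
def IsBddStarForestIn {V : Type} (G : SimpleGraph V) (k : ℕ) (S : Set (Sym2 V)) : Prop :=
  S ⊆ G.edgeSet ∧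
  (∀ e ∈ S, ∃ v : V, v ∈ e ∧ {f ∈ S | v ∈ f}.ncard = 1) ∧
  (∀ v : V, {f ∈ S | v ∈ f}.ncard ≤ k)

/-- `(M, S)` is a partition of the edge set of `G` into a matching `M` and a `k`-bounded
star forest `S`. -/
def IsMSFDecomp {V : Type} (G : SimpleGraph V) (k : ℕ) (M S : Set (Sym2 V)) : Prop :=
  M ∪ S = G.edgeSet ∧ Disjoint M S ∧ IsMatchingIn G M ∧ IsBddStarForestIn G k S

section Family

variable {V : Type} [Fintype V] [DecidableEq V]

/-- `P` is the edge set of a path in `G` from `u` to `w` (with at least one edge), both of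
whose endpoints have degree at least `3` or exactly `1` in `G`, and all of whose interior
vertices have degree exactly `2` in `G`. -/
def GoodPathEnds (G : SimpleGraph V) [DecidableRel G.Adj]
    (P : Set (Sym2 V)) (u w : V) : Prop :=
  ∃ p : G.Walk u w, p.IsPath ∧ 1 ≤ p.length ∧ {e : Sym2 V | e ∈ p.edges} = P ∧
    (3 ≤ G.degree u ∨ G.degree u = 1) ∧ (3 ≤ G.degree w ∨ G.degree w = 1) ∧
    (∀ v ∈ p.support, v ≠ u → v ≠ w → G.degree v = 2)

/-- `P` is the edge set of a cycle in `G` containing at most one vertex of degree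
at least `3` in `G`. -/
def GoodCycle (G : SimpleGraph V) [DecidableRel G.Adj] (P : Set (Sym2 V)) : Prop :=
  ∃ (u : V) (p : G.Walk u u), p.IsCycle ∧ {e : Sym2 V | e ∈ p.edges} = P ∧
    {v : V | v ∈ p.support ∧ 3 ≤ G.degree v}.ncard ≤ 1

/-- `P` belongs to the family `𝒫`: it is (the edge set of) a path of `G` with both endpoints
of degree at least `3` or exactly `1` and all interior vertices of degree `2`, or a cycle of
`G` containing at most one vertex of degree at least `3`. -/
def MemFam (G : SimpleGraph V) [DecidableRel G.Adj] (P : Set (Sym2 V)) : Prop :=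
  (∃ u w : V, GoodPathEnds G P u w) ∨ GoodCycle G P

/-- `x` is an endpoint of the member `P` of `𝒫` (for a cycle, a vertex lying on it). -/
def IsEnd (G : SimpleGraph V) [DecidableRel G.Adj] (x : V) (P : Set (Sym2 V)) : Prop :=
  (∃ w : V, GoodPathEnds G P x w ∨ GoodPathEnds G P w x) ∨
  (GoodCycle G P ∧ ∃ e ∈ P, x ∈ e)

end Family

/-- `W` marks the matching edges among the `n` consecutive edges of a path: the first and last
edges are marked according to `a` and `b`, no two consecutive edges are marked, and every
unmarked edge is next to a marked one. -/
def IsMarking (n : ℕ) (a b : Bool) (W : ℕ → Bool) : Prop :=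
  W 0 = a ∧ W (n - 1) = b ∧ (∀ i < n, i + 1 < n → W i = true → W (i + 1) = false) ∧
    ∀ i < n, W i = false → (0 < i ∧ W (i - 1) = true) ∨ (i + 1 < n ∧ W (i + 1) = true)

instance (n : ℕ) (a b : Bool) (W : ℕ → Bool) : Decidable (IsMarking n a b W) := by
  unfold IsMarking; infer_instance

theorem IsMarking.add_two {n : ℕ} {a b : Bool} {W : ℕ → Bool} (hn : 0 < n)
    (h : IsMarking n a b W) :
    IsMarking (n + 2) a b (fun i => if i = 0 then a else if i = 1 then !a else W (i - 2)) := by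
  obtain ⟨h0, h1, h2, h3⟩ := h
  refine ⟨by simp, ?_, ?_, ?_⟩
  · have : n + 2 - 1 ≠ 0 ∧ n + 2 - 1 ≠ 1 := by omega
    simp only [this.1, this.2, if_false]
    rw [← h1]; congr 1
  · intro i _ hi
    rcases i with _ | _ | i
    · simp
    · simp [h0]
    · simpa using h2 i (by omega) (by omega)
  · intro i hi hW
    rcases i with _ | _ | i
    · right; simp_all
    · simp only [zero_add, one_ne_zero, if_false, if_true] at hW
      left; simp_all
    · rcases h3 i (by omega) (by simpa using hW) with ⟨hi0, h⟩ | ⟨hi1, h⟩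
      · left
        obtain ⟨j, rfl⟩ : ∃ j, i = j + 1 := ⟨i - 1, by omega⟩
        simpa using h
      · right
        exact ⟨by omega, by simpa using h⟩

theorem exists_isMarking (n : ℕ) (hn : 0 < n) (a b : Bool) (h1 : n = 1 → a = true ∧ b = true)
    (h2 : n = 2 → a ≠ b) (h3 : n = 3 → a = b) (h4 : n = 4 → a = true ∨ b = true) :
    ∃ W, IsMarking n a b W := by
  induction n using Nat.strong_induction_on generalizing a b with
  | _ n ih =>
    have step : ∀ m, n = m + 2 → 0 < m → (m = 1 → a = true ∧ b = true) → (m = 2 → a ≠ b) →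
        (m = 3 → a = b) → (m = 4 → a = true ∨ b = true) → ∃ W, IsMarking n a b W := by
      rintro m rfl hm g1 g2 g3 g4
      obtain ⟨W, hW⟩ := ih m (by omega) hm a b g1 g2 g3 g4
      exact ⟨_, hW.add_two hm⟩
    have base : ∀ l : List Bool, IsMarking n a b (fun i => l.getD i false) →
        ∃ W, IsMarking n a b W := fun l hl => ⟨_, hl⟩
    by_cases hn7 : 7 ≤ n
    · exact step (n - 2) (by omega) (by omega) (by omega) (by omega) (by omega) (by omega)
    have hn' : n = 1 ∨ n = 2 ∨ n = 3 ∨ n = 4 ∨ n = 5 ∨ n = 6 := by omega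
    clear ih step
    rcases hn' with rfl | rfl | rfl | rfl | rfl | rfl <;> cases a <;> cases b <;>
      simp at h1 h2 h3 h4
    · exact base [true] (by decide)
    · exact base [false, true] (by decide)
    · exact base [true, false] (by decide)
    · exact base [false, true, false] (by decide)
    · exact base [true, false, true] (by decide)
    · exact base [false, true, false, true] (by decide)
    · exact base [true, false, true, false] (by decide)
    · exact base [true, false, false, true] (by decide)
    · exact base [false, true, false, true, false] (by decide)
    · exact base [false, true, false, false, true] (by decide)
    · exact base [true, false, false, true, false] (by decide)
    · exact base [true, false, true, false, true] (by decide)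
    · exact base [false, true, false, false, true, false] (by decide)
    · exact base [false, true, false, true, false, true] (by decide)
    · exact base [true, false, true, false, true, false] (by decide)
    · exact base [true, false, true, false, false, true] (by decide)

open Classical in
theorem ncard_eq_of_subset_pair {α : Type*} {A : Set α} {x y : α} (hA : A ⊆ {x, y}) :
    A.ncard = (decide (x ∈ A)).toNat + (decide (y ≠ x ∧ y ∈ A)).toNat := by
  rcases Set.subset_pair_iff_eq.1 hA with rfl | rfl | rfl | rfl
  · simp
  · by_cases h : y = x <;> simp [h]
  · by_cases h : y = x
    · simp [h]
    · simp [h, Ne.symm h]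
  · by_cases h : y = x
    · simp [h]
    · simp [h, Set.ncard_pair (Ne.symm h)]

section Threads

variable {V : Type} [Fintype V]

theorem eq_or_eq_of_degree_two (G : SimpleGraph V) [DecidableRel G.Adj] {v : V}
    (hv : G.degree v = 2) {a b f : Sym2 V} (ha : a ∈ G.edgeSet) (hb : b ∈ G.edgeSet)
    (hf : f ∈ G.edgeSet) (hva : v ∈ a) (hvb : v ∈ b) (hvf : v ∈ f) (hab : a ≠ b) :
    f = a ∨ f = b := by
  classical
  have hsub : ({a, b} : Finset (Sym2 V)) ⊆ G.incidenceFinset v := by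
    intro e he
    rw [SimpleGraph.mem_incidenceFinset]
    rcases Finset.mem_insert.1 he with rfl | he
    · exact ⟨ha, hva⟩
    · rw [Finset.mem_singleton.1 he]; exact ⟨hb, hvb⟩
  have heq := Finset.eq_of_subset_of_card_le hsub
    (by rw [SimpleGraph.card_incidenceFinset_eq_degree, hv, Finset.card_pair hab])
  have : f ∈ ({a, b} : Finset (Sym2 V)) := by
    rw [heq, SimpleGraph.mem_incidenceFinset]; exact ⟨hf, hvf⟩
  simpa using this

/-- The `n` consecutive edges along `g` are distinct and form the set `P`; all interior vertices
have degree `2`, and either the thread closes up or both of its ends have degree other than `2`. -/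
structure IsThread (G : SimpleGraph V) [DecidableRel G.Adj] (P : Set (Sym2 V)) (g : ℕ → V)
    (n : ℕ) : Prop where
  pos : 0 < n
  adj : ∀ i < n, G.Adj (g i) (g (i + 1))
  inj : ∀ i < n, ∀ j < n, s(g i, g (i + 1)) = s(g j, g (j + 1)) → i = j
  mem_iff : ∀ e, e ∈ P ↔ ∃ i < n, s(g i, g (i + 1)) = e
  degree_eq : ∀ i, 0 < i → i < n → G.degree (g i) = 2
  ends : g 0 = g n ∨ (G.degree (g 0) ≠ 2 ∧ G.degree (g n) ≠ 2)

namespace IsThread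

variable {G : SimpleGraph V} [DecidableRel G.Adj] {P Q : Set (Sym2 V)} {g g' : ℕ → V} {n n' : ℕ}

theorem mem_edgeSet (h : IsThread G P g n) {i : ℕ} (hi : i < n) :
    s(g i, g (i + 1)) ∈ G.edgeSet := h.adj i hi

theorem subset_edgeSet (h : IsThread G P g n) : P ⊆ G.edgeSet := by
  intro e he
  obtain ⟨i, hi, rfl⟩ := (h.mem_iff e).1 he
  exact h.adj i hi

theorem edge_mem (h : IsThread G P g n) {i : ℕ} (hi : i < n) : s(g i, g (i + 1)) ∈ P :=
  (h.mem_iff _).2 ⟨i, hi, rfl⟩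

theorem ncard_eq (h : IsThread G P g n) : P.ncard = n := by
  have hP : P = (fun i => s(g i, g (i + 1))) '' (Set.Iio n) := by
    ext e
    rw [h.mem_iff]; rfl
  have hinj : Set.InjOn (fun i => s(g i, g (i + 1))) (Set.Iio n) :=
    fun i hi j hj hij => h.inj i hi j hj hij
  rw [hP, hinj.ncard_image]
  simp [Set.ncard_eq_toFinset_card']

theorem ne_of_lt (h : IsThread G P g n) {i j : ℕ} (hi : i < j) (hj : j < n) :
    s(g i, g (i + 1)) ≠ s(g j, g (j + 1)) :=
  fun he => hi.ne (h.inj i (hi.trans hj) j hj he)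

theorem exists_index (h : IsThread G P g n) {e : Sym2 V} (he : e ∈ P) {v : V} (hv : v ∈ e) :
    ∃ m ≤ n, v = g m := by
  obtain ⟨i, hi, rfl⟩ := (h.mem_iff e).1 he
  rcases Sym2.mem_iff.1 hv with rfl | rfl
  · exact ⟨i, hi.le, rfl⟩
  · exact ⟨i + 1, hi, rfl⟩

theorem interior_edge (h : IsThread G P g n) {m : ℕ} (hm : m + 1 < n) {e : Sym2 V}
    (he : e ∈ G.edgeSet) (hv : g (m + 1) ∈ e) :
    e = s(g m, g (m + 1)) ∨ e = s(g (m + 1), g (m + 1 + 1)) :=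
  eq_or_eq_of_degree_two G (h.degree_eq (m + 1) (by omega) hm) (h.mem_edgeSet (by omega))
    (h.mem_edgeSet hm) he (by simp) (by simp) hv (h.ne_of_lt (by omega) hm)

theorem interior_index (h : IsThread G P g n) {m i : ℕ} (hm : m + 1 < n) (hi : i < n)
    (hv : g (m + 1) ∈ s(g i, g (i + 1))) : i = m ∨ i = m + 1 := by
  rcases h.interior_edge hm (h.mem_edgeSet hi) hv with he | he
  · exact Or.inl (h.inj i hi m (by omega) he)
  · exact Or.inr (h.inj i hi (m + 1) hm he)

theorem closed_under_adjacency (h : IsThread G P g n) {e f : Sym2 V} {v : V} (he : e ∈ P)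
    (hf : f ∈ G.edgeSet) (hve : v ∈ e) (hvf : v ∈ f) (hv : G.degree v = 2) : f ∈ P := by
  obtain ⟨m, hm, rfl⟩ := h.exists_index he hve
  by_cases hint : 0 < m ∧ m < n
  · obtain ⟨j, rfl⟩ : ∃ j, m = j + 1 := ⟨m - 1, by omega⟩
    rcases h.interior_edge hint.2 hf hvf with rfl | rfl
    · exact h.edge_mem (by omega)
    · exact h.edge_mem hint.2
  · have hend : g m = g 0 ∧ g m = g n := by
      have : m = 0 ∨ m = n := by omega
      rcases h.ends with h0 | ⟨h0, h1⟩
      · rcases this with rfl | rfl <;> simp [h0]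
      · rcases this with rfl | rfl <;> contradiction
    have hpos := h.pos
    have hn : 1 < n := by
      by_contra hn
      obtain rfl : n = 1 := by omega
      exact (h.adj 0 (by omega)).ne (hend.1.symm.trans hend.2)
    obtain ⟨j, rfl⟩ : ∃ j, n = j + 1 := ⟨n - 1, by omega⟩
    rcases eq_or_eq_of_degree_two G hv (h.mem_edgeSet (i := 0) (by omega))
      (h.mem_edgeSet (i := j) (by omega)) hf (by simp [hend.1]) (by simp [hend.2]) hvf
      (h.ne_of_lt (by omega) (by omega)) with rfl | rfl
    · exact h.edge_mem (by omega)
    · exact h.edge_mem (by omega)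

theorem subset_of_mem (h : IsThread G P g n) (h' : IsThread G Q g' n') {e : Sym2 V}
    (heP : e ∈ P) (heQ : e ∈ Q) : P ⊆ Q := by
  obtain ⟨i, hi, rfl⟩ := (h.mem_iff e).1 heP
  have up : ∀ d, i + d < n → s(g (i + d), g (i + d + 1)) ∈ Q := by
    intro d
    induction d with
    | zero => intro _; exact heQ
    | succ d ih =>
      intro hd
      exact h'.closed_under_adjacency (v := g (i + d + 1)) (ih (by omega)) (h.mem_edgeSet hd)
        (by simp) (by simp [add_assoc]) (h.degree_eq _ (by omega) (by omega))
  have down : ∀ j ≤ i, s(g j, g (j + 1)) ∈ Q := by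
    intro j hj
    induction hj using Nat.decreasingInduction with
    | self => exact heQ
    | of_succ j hj ih =>
      exact h'.closed_under_adjacency (v := g (j + 1)) ih (h.mem_edgeSet (by omega))
        (by simp) (by simp) (h.degree_eq _ (by omega) (by omega))
  intro f hf
  obtain ⟨j, hj, rfl⟩ := (h.mem_iff f).1 hf
  rcases le_total j i with hji | hij
  · exact down j hji
  · obtain ⟨d, rfl⟩ := Nat.exists_eq_add_of_le hij
    exact up d hj

theorem eq_of_mem (h : IsThread G P g n) (h' : IsThread G Q g' n') {e : Sym2 V}
    (heP : e ∈ P) (heQ : e ∈ Q) : P = Q :=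
  (h.subset_of_mem h' heP heQ).antisymm (h'.subset_of_mem h heQ heP)

theorem eq_end_of_three_le (h : IsThread G P g n) {v : V} (hv : 3 ≤ G.degree v) {i : ℕ}
    (hi : i < n) (hvi : v ∈ s(g i, g (i + 1))) : (i = 0 ∧ v = g 0) ∨ (i + 1 = n ∧ v = g n) := by
  rcases Sym2.mem_iff.1 hvi with rfl | rfl
  · rcases Nat.eq_zero_or_pos i with rfl | h0
    · simp
    · have := h.degree_eq i h0 hi; omega
  · rcases (Nat.succ_le_of_lt hi).lt_or_eq with h0 | h0
    · have := h.degree_eq (i + 1) (by omega) h0; omega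
    · exact Or.inr ⟨h0, by rw [← h0]⟩

theorem exists_matching (h : IsThread G P g n) {A : Set V}
    (hA : ∀ x ∈ A, 3 ≤ G.degree x ∧ ∃ e ∈ P, x ∈ e)
    (h1 : n = 1 → A.ncard = 2) (h2 : n = 2 → A.ncard = 1)
    (h3 : n = 3 → A.ncard = 0 ∨ A.ncard = 2) (h4 : n = 4 → A.ncard = 1 ∨ A.ncard = 2) :
    ∃ L ⊆ P, (∀ e ∈ L, ∀ f ∈ L, e ≠ f → ∀ v, 2 ≤ G.degree v → v ∈ e → v ∉ f) ∧
      (∀ v, 3 ≤ G.degree v → ((∃ e ∈ L, v ∈ e) ↔ v ∈ A)) ∧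
      (∀ e ∈ P, e ∉ L → ∃ v ∈ e, G.degree v = 2 ∧ ∃ f ∈ L, v ∈ f) := by
  classical
  have hpos := h.pos
  set a : Bool := decide (g 0 ∈ A) with ha
  set b : Bool := decide (g n ≠ g 0 ∧ g n ∈ A) with hb
  have hAend : A ⊆ {g 0, g n} := by
    intro x hx
    obtain ⟨hd, e, he, hxe⟩ := hA x hx
    obtain ⟨i, hi, rfl⟩ := (h.mem_iff e).1 he
    rcases h.eq_end_of_three_le hd hi hxe with ⟨-, rfl⟩ | ⟨-, rfl⟩ <;> simp
  have hcard : A.ncard = a.toNat + b.toNat := ncard_eq_of_subset_pair hAend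
  clear_value a b
  obtain ⟨W, hW0, hW1, hW2, hW3⟩ := exists_isMarking n hpos a b
    (fun hn => by have := h1 hn; rw [hcard] at this; revert this; cases a <;> cases b <;> simp)
    (fun hn => by have := h2 hn; rw [hcard] at this; revert this; cases a <;> cases b <;> simp)
    (fun hn => by have := h3 hn; rw [hcard] at this; revert this; cases a <;> cases b <;> simp)
    (fun hn => by have := h4 hn; rw [hcard] at this; revert this; cases a <;> cases b <;> simp)
  have hlast : g 0 = g n → W (n - 1) = false := by
    intro h0; rw [hW1, hb]; simp [h0]
  have key : ∀ i j, i < j → j < n → W i = true → W j = true → ∀ v, 2 ≤ G.degree v →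
      v ∈ s(g i, g (i + 1)) → v ∉ s(g j, g (j + 1)) := by
    intro i j hij hj hWi hWj v hv hvi hvj
    have hcons : j ≠ i + 1 := by
      rintro rfl
      rw [hW2 i (by omega) hj hWi] at hWj
      cases hWj
    rcases Sym2.mem_iff.1 hvi with rfl | rfl
    · rcases Nat.eq_zero_or_pos i with rfl | hi0
      · rcases Sym2.mem_iff.1 hvj with hv0 | hv0
        · obtain ⟨m, rfl⟩ : ∃ m, j = m + 1 := ⟨j - 1, by omega⟩
          have := h.interior_index hj hpos (hv0 ▸ Sym2.mem_mk_left _ _)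
          omega
        · by_cases hjn : j + 1 < n
          · have := h.interior_index hjn hpos (hv0 ▸ Sym2.mem_mk_left _ _)
            omega
          · obtain rfl : n = j + 1 := by omega
            have := hlast hv0
            simp_all
      · obtain ⟨m, rfl⟩ : ∃ m, i = m + 1 := ⟨i - 1, by omega⟩
        have := h.interior_index (by omega) hj hvj
        omega
    · have := h.interior_index (by omega) hj hvj
      omega
  refine ⟨{e | ∃ i < n, s(g i, g (i + 1)) = e ∧ W i = true}, ?_, ?_, ?_, ?_⟩
  · rintro e ⟨i, hi, rfl, -⟩
    exact h.edge_mem hi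
  · rintro e ⟨i, hi, rfl, hWi⟩ f ⟨j, hj, rfl, hWj⟩ hne v hv hvi hvj
    rcases lt_trichotomy i j with hij | rfl | hij
    · exact key i j hij hj hWi hWj v hv hvi hvj
    · exact hne rfl
    · exact key j i hij hi hWj hWi v hv hvj hvi
  · intro v hv
    constructor
    · rintro ⟨e, ⟨i, hi, rfl, hWi⟩, hve⟩
      rcases h.eq_end_of_three_le hv hi hve with ⟨rfl, rfl⟩ | ⟨rfl, rfl⟩
      · rw [hWi, ha, eq_comm] at hW0
        exact of_decide_eq_true hW0
      · rw [Nat.add_sub_cancel, hWi, hb, eq_comm] at hW1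
        exact (of_decide_eq_true hW1).2
    · intro hvA
      by_cases h0 : v = g 0
      · subst h0
        exact ⟨_, ⟨0, hpos, rfl, by rw [hW0, ha]; exact decide_eq_true hvA⟩, by simp⟩
      · obtain rfl : v = g n := by
          rcases hAend hvA with h' | h'
          · exact absurd h' h0
          · exact h'
        refine ⟨_, ⟨n - 1, by omega, rfl, by rw [hW1, hb]; exact decide_eq_true ⟨h0, hvA⟩⟩, ?_⟩
        rw [Nat.sub_add_cancel hpos]; simp
  · intro e he heL
    obtain ⟨i, hi, rfl⟩ := (h.mem_iff e).1 he
    have hWi : W i = false := by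
      by_contra hWi
      exact heL ⟨i, hi, rfl, by simpa using hWi⟩
    rcases hW3 i hi hWi with ⟨hi0, hWm⟩ | ⟨hi1, hWp⟩
    · refine ⟨g i, by simp, h.degree_eq i hi0 hi, _, ⟨i - 1, by omega, rfl, hWm⟩, ?_⟩
      rw [Nat.sub_add_cancel hi0]; simp
    · exact ⟨g (i + 1), by simp, h.degree_eq _ (by omega) hi1, _, ⟨i + 1, hi1, rfl, hWp⟩,
        by simp⟩

end IsThread

theorem mem_edges_iff_exists {V : Type} {G : SimpleGraph V} {u w : V} (p : G.Walk u w) (e : Sym2 V) :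
    e ∈ p.edges ↔ ∃ i < p.length, s(p.getVert i, p.getVert (i + 1)) = e := by
  induction e with
  | _ x y => exact p.mk_mem_edges_iff_exists

theorem isThread_of_isTrail {G : SimpleGraph V} [DecidableRel G.Adj] {u w : V} {p : G.Walk u w}
    (hp : p.IsTrail) (hpos : 0 < p.length)
    (hdeg : ∀ i, 0 < i → i < p.length → G.degree (p.getVert i) = 2)
    (hends : u = w ∨ (G.degree u ≠ 2 ∧ G.degree w ≠ 2)) :
    IsThread G {e | e ∈ p.edges} p.getVert p.length where
  pos := hpos
  adj _ hi := p.adj_getVert_succ hi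
  inj i hi j hj hij := by
    rw [← p.length_edges] at hi hj
    rw [← SimpleGraph.Walk.getElem_edges hi, ← SimpleGraph.Walk.getElem_edges hj] at hij
    exact (hp.edges_nodup.getElem_inj_iff).1 hij
  mem_iff := mem_edges_iff_exists p
  degree_eq := hdeg
  ends := by rwa [p.getVert_zero, p.getVert_length]

theorem two_le_degree_of_isCycle {G : SimpleGraph V} [DecidableRel G.Adj] {u : V}
    {p : G.Walk u u} (hp : p.IsCycle) {i : ℕ} (hi0 : 0 < i) (hi : i < p.length) :
    2 ≤ G.degree (p.getVert i) := by
  have h1 : G.Adj (p.getVert i) (p.getVert (i - 1)) := by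
    have := p.adj_getVert_succ (i := i - 1) (by omega)
    rw [Nat.sub_add_cancel hi0] at this
    exact this.symm
  have h2 := p.adj_getVert_succ hi
  rw [← SimpleGraph.card_neighborFinset_eq_degree, Nat.succ_le_iff, Finset.one_lt_card]
  exact ⟨_, (G.mem_neighborFinset _ _).2 h1, _, (G.mem_neighborFinset _ _).2 h2,
    hp.getVert_sub_one_ne_getVert_add_one hi.le⟩

/-- `p` is a path through the edge `e` whose interior vertices all have degree `2`. -/
def IsPathThrough (G : SimpleGraph V) [DecidableRel G.Adj] (e : Sym2 V) {u w : V}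
    (p : G.Walk u w) : Prop :=
  p.IsPath ∧ e ∈ p.edges ∧ ∀ v ∈ p.support, v ≠ u → v ≠ w → G.degree v = 2

theorem IsPathThrough.reverse {G : SimpleGraph V} [DecidableRel G.Adj] {e : Sym2 V} {u w : V}
    {p : G.Walk u w} (h : IsPathThrough G e p) : IsPathThrough G e p.reverse :=
  ⟨h.1.reverse, by simpa using h.2.1, fun v hv h1 h2 => h.2.2 v (by simpa using hv) h2 h1⟩

variable [DecidableEq V]

theorem GoodPathEnds.exists_isThread {G : SimpleGraph V} [DecidableRel G.Adj]
    {P : Set (Sym2 V)} {u w : V} (h : GoodPathEnds G P u w) :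
    ∃ g n, IsThread G P g n ∧ g 0 = u ∧ g n = w := by
  obtain ⟨p, hp, hlen, rfl, hu, hw, hint⟩ := h
  refine ⟨p.getVert, p.length, isThread_of_isTrail hp.isTrail hlen ?_ (by omega), by simp, by simp⟩
  intro i hi0 hi
  refine hint _ (p.getVert_mem_support i) ?_ ?_
  · rw [Ne, hp.getVert_eq_start_iff hi.le]; omega
  · rw [Ne, hp.getVert_eq_end_iff hi.le]; omega

theorem GoodCycle.exists_isThread {G : SimpleGraph V} [DecidableRel G.Adj]
    {P : Set (Sym2 V)} (h : GoodCycle G P) : ∃ g n, IsThread G P g n := by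
  obtain ⟨u, p, hp, rfl, hcard⟩ := h
  obtain ⟨v, q, hq, hqe, hv⟩ : ∃ (v : V) (q : G.Walk v v), q.IsCycle ∧
      (∀ e, e ∈ q.edges ↔ e ∈ p.edges) ∧ ∀ x ∈ q.support, 3 ≤ G.degree x → x = v := by
    by_cases hb : ∃ v ∈ p.support, 3 ≤ G.degree v
    · obtain ⟨v, hvp, hvd⟩ := hb
      refine ⟨v, p.rotate v hvp, hp.rotate hvp, fun e => (p.rotate_edges v hvp).mem_iff, ?_⟩
      intro x hx hxd
      rw [SimpleGraph.Walk.mem_support_rotate_iff] at hx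
      exact (Set.ncard_le_one (Set.toFinite _)).1 hcard x ⟨hx, hxd⟩ v ⟨hvp, hvd⟩
    · exact ⟨u, p, hp, fun _ => Iff.rfl, fun x hx hxd => absurd ⟨x, hx, hxd⟩ hb⟩
  have hP : {e | e ∈ p.edges} = {e | e ∈ q.edges} := by ext e; simp [hqe]
  rw [hP]
  refine ⟨_, _, isThread_of_isTrail hq.isTrail (by have := hq.three_le_length; omega) ?_
    (Or.inl rfl)⟩
  intro i hi0 hi
  have h2 := two_le_degree_of_isCycle hq hi0 hi
  by_contra hne
  have := (hq.getVert_endpoint_iff hi.le).1 (hv _ (q.getVert_mem_support i) (by omega))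
  omega

theorem MemFam.exists_isThread {G : SimpleGraph V} [DecidableRel G.Adj]
    {P : Set (Sym2 V)} (h : MemFam G P) : ∃ g n, IsThread G P g n := by
  rcases h with ⟨u, w, h⟩ | h
  · obtain ⟨g, n, h, -⟩ := h.exists_isThread
    exact ⟨g, n, h⟩
  · exact h.exists_isThread

theorem IsEnd.exists_mem {G : SimpleGraph V} [DecidableRel G.Adj] {x : V} {P : Set (Sym2 V)}
    (h : IsEnd G x P) : ∃ e ∈ P, x ∈ e := by
  rcases h with ⟨w, h | h⟩ | ⟨-, h⟩
  · obtain ⟨g, n, ht, rfl, -⟩ := h.exists_isThread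
    exact ⟨_, ht.edge_mem ht.pos, by simp⟩
  · obtain ⟨g, n, ht, -, rfl⟩ := h.exists_isThread
    have hpos := ht.pos
    refine ⟨_, ht.edge_mem (i := n - 1) (by omega), ?_⟩
    rw [Nat.sub_add_cancel hpos]; simp
  · exact h

theorem IsPathThrough.extend_or_close {G : SimpleGraph V} [DecidableRel G.Adj] {e : Sym2 V}
    {u w : V} {p : G.Walk u w} (h : IsPathThrough G e p) (hu : G.degree u = 2) :
    (∃ (z : V) (q : G.Walk z w), IsPathThrough G e q ∧ p.length < q.length) ∨
      ∃ P, GoodCycle G P ∧ e ∈ P := by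
  obtain ⟨hp, he, hint⟩ := h
  have hpos : 0 < p.length := by
    rw [← p.length_edges]; exact List.length_pos_of_mem he
  have hadj1 : G.Adj u (p.getVert 1) := by simpa using p.adj_getVert_succ hpos
  obtain ⟨z, hzadj, hz1⟩ : ∃ z, G.Adj u z ∧ z ≠ p.getVert 1 := by
    rw [← SimpleGraph.card_neighborFinset_eq_degree] at hu
    obtain ⟨z, hz, hne⟩ := Finset.exists_mem_ne (by omega : 1 < (G.neighborFinset u).card)
      (p.getVert 1)
    exact ⟨z, (G.mem_neighborFinset _ _).1 hz, hne⟩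
  have hnot : s(z, u) ∉ p.edges := by
    intro hmem
    obtain ⟨i, hi, hie⟩ := (mem_edges_iff_exists p _).1 hmem
    rcases Sym2.eq_iff.1 hie with ⟨-, h2⟩ | ⟨h1, h2⟩
    · have := (hp.getVert_eq_start_iff hi).1 h2
      omega
    · have := (hp.getVert_eq_start_iff hi.le).1 h1
      subst this
      exact hz1 h2.symm
  by_cases hzp : z ∈ p.support
  · right
    by_cases hzw : z = w
    · subst hzw
      refine ⟨_, ⟨z, SimpleGraph.Walk.cons hzadj.symm p, ?_, rfl, ?_⟩, ?_⟩
      · exact (SimpleGraph.Walk.cons_isCycle_iff _ _).2 ⟨hp, hnot⟩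
      · rw [Set.ncard_le_one (Set.toFinite _)]
        have : ∀ x, x ∈ (SimpleGraph.Walk.cons hzadj.symm p).support ∧ 3 ≤ G.degree x → x = z := by
          rintro x ⟨hx, hxd⟩
          by_contra hxz
          have hxp : x ∈ p.support := by simpa [hxz] using hx
          by_cases hxu : x = u
          · subst hxu; omega
          · have := hint x hxp hxu hxz; omega
        intro x hx y hy
        rw [this x hx, this y hy]
      · simp [he]
    · exfalso
      obtain ⟨i, rfl, hi⟩ := SimpleGraph.Walk.mem_support_iff_exists_getVert.1 hzp
      have hi0 : i ≠ 0 := by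
        rintro rfl
        simp at hzadj
      have hin : i ≠ p.length := by
        rintro rfl
        simp at hzw
      obtain ⟨m, rfl⟩ := Nat.exists_eq_succ_of_ne_zero hi0
      have hd : G.degree (p.getVert (m + 1)) = 2 := hint _ hzp hzadj.ne' hzw
      have hlt : m + 1 < p.length := by omega
      have hne : s(p.getVert m, p.getVert (m + 1)) ≠
          s(p.getVert (m + 1), p.getVert (m + 1 + 1)) := by
        intro heq
        have hmm : p.getVert m = p.getVert (m + 1 + 1) := by
          rcases Sym2.eq_iff.1 heq with ⟨h1, h2⟩ | ⟨h1, -⟩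
          · exact h1.trans h2
          · exact h1
        have := hp.getVert_injOn (show m ≤ p.length by omega) (show m + 1 + 1 ≤ p.length by omega)
          hmm
        omega
      rcases eq_or_eq_of_degree_two G hd (p.adj_getVert_succ (i := m) (by omega))
        (p.adj_getVert_succ hlt) ((SimpleGraph.mem_edgeSet _).2 hzadj.symm)
        (by simp) (by simp) (by simp) hne with heq | heq
      · exact hnot ((mem_edges_iff_exists p _).2 ⟨m, by omega, heq.symm⟩)
      · exact hnot ((mem_edges_iff_exists p _).2 ⟨m + 1, hlt, heq.symm⟩)
  · left
    refine ⟨z, SimpleGraph.Walk.cons hzadj.symm p, ⟨?_, by simp [he], ?_⟩, by simp⟩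
    · exact (SimpleGraph.Walk.cons_isPath_iff _ _).2 ⟨hp, hzp⟩
    · intro v hv hvz hvw
      have hvp : v ∈ p.support := by simpa [hvz] using hv
      by_cases hvu : v = u
      · rw [hvu, hu]
      · exact hint v hvp hvu hvw

theorem exists_memFam_of_mem_edgeSet (G : SimpleGraph V) [DecidableRel G.Adj] {e : Sym2 V}
    (he : e ∈ G.edgeSet) : ∃ P, MemFam G P ∧ e ∈ P := by
  by_contra hcon
  have key : ∀ m : ℕ, ∃ (u w : V) (p : G.Walk u w), IsPathThrough G e p ∧ m < p.length := by
    intro m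
    induction m with
    | zero =>
      induction e with
      | _ x y =>
        have hxy : G.Adj x y := he
        refine ⟨x, y, SimpleGraph.Walk.cons hxy .nil, ⟨?_, by simp, ?_⟩, by simp⟩
        · simp [hxy.ne]
        · intro v hv h1 h2
          simp [h1, h2] at hv
    | succ m ih =>
      obtain ⟨u, w, p, hp, hm⟩ := ih
      have hclose : ∀ {u w : V} {p : G.Walk u w}, IsPathThrough G e p → m < p.length →
          G.degree u = 2 →
          ∃ (u w : V) (p : G.Walk u w), IsPathThrough G e p ∧ m + 1 < p.length := by
        intro u w p hp hm hu
        rcases hp.extend_or_close hu with ⟨z, q, hq, hlt⟩ | ⟨P, hP, heP⟩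
        · exact ⟨z, w, q, hq, by omega⟩
        · exact absurd ⟨P, Or.inr hP, heP⟩ hcon
      by_cases hu : G.degree u = 2
      · exact hclose hp hm hu
      by_cases hw : G.degree w = 2
      · exact hclose hp.reverse (by simpa using hm) hw
      refine absurd ⟨_, Or.inl ⟨u, w, p, hp.1, by omega, rfl, ?_, ?_, hp.2.2⟩, hp.2.1⟩ hcon
      · have : 0 < G.degree u := (G.degree_pos_iff_exists_adj u).2
          ⟨_, by simpa using p.adj_getVert_succ (i := 0) (by omega)⟩
        omega
      · have : 0 < G.degree w := (G.degree_pos_iff_exists_adj w).2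
          ⟨p.getVert (p.length - 1), by
            have := p.adj_getVert_succ (i := p.length - 1) (by omega)
            rw [Nat.sub_add_cancel (by omega), p.getVert_length] at this
            exact this.symm⟩
        omega
  obtain ⟨u, w, p, hp, hlt⟩ := key (Fintype.card V)
  exact absurd hp.1.length_lt (by omega)

theorem eq_of_memFam_of_mem {G : SimpleGraph V} [DecidableRel G.Adj] {P Q : Set (Sym2 V)}
    (hP : MemFam G P) (hQ : MemFam G Q) {e : Sym2 V} (heP : e ∈ P) (heQ : e ∈ Q) : P = Q := by
  obtain ⟨g, n, h⟩ := hP.exists_isThread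
  obtain ⟨g', n', h'⟩ := hQ.exists_isThread
  exact h.eq_of_mem h' heP heQ

end Threads

/-- If the auxiliary bipartite small-gap general factor instance built from `G`
(vertex classes: vertices of degree ≥ 3 of `G`, and the members of the family `𝒫` of paths
between branch/leaf vertices through degree-2 vertices together with cycles with at most one
branch vertex; `x` joined to `P` when `x` is an endpoint of `P`; degree targets `A_v` as
prescribed) has a solution `S` (a set of edges of the bipartite graph, encoded as incident
pairs `(x, P)`), then the edge set of `G` admits a partition into a matching and a
`k`-bounded star forest. -/
theorem sggf_to_msfd {V : Type} [Fintype V] [DecidableEq V] (G : SimpleGraph V)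
    [DecidableRel G.Adj] (k : ℕ) (hk : 2 ≤ k) (hΔ : ∀ v : V, G.degree v ≤ k + 1)
    (S : Set (V × Set (Sym2 V)))
    (hS : S ⊆ {q : V × Set (Sym2 V) | 3 ≤ G.degree q.1 ∧ MemFam G q.2 ∧ IsEnd G q.1 q.2})
    (hX1 : ∀ x : V, k + 1 ≤ G.degree x →
      {P : Set (Sym2 V) | (x, P) ∈ S}.ncard ∈ ({1} : Set ℕ))
    (hX2 : ∀ x : V, 3 ≤ G.degree x → ¬ k + 1 ≤ G.degree x →
      {P : Set (Sym2 V) | (x, P) ∈ S}.ncard ∈ ({0, 1} : Set ℕ))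
    (hP1 : ∀ P : Set (Sym2 V), MemFam G P → P.ncard = 1 →
      {x : V | (x, P) ∈ S}.ncard ∈ ({2} : Set ℕ))
    (hP2 : ∀ P : Set (Sym2 V), MemFam G P → P.ncard = 2 →
      {x : V | (x, P) ∈ S}.ncard ∈ ({1} : Set ℕ))
    (hP3 : ∀ P : Set (Sym2 V), MemFam G P → P.ncard = 3 →
      {x : V | (x, P) ∈ S}.ncard ∈ ({0, 2} : Set ℕ))
    (hP4 : ∀ P : Set (Sym2 V), MemFam G P → P.ncard = 4 →
      {x : V | (x, P) ∈ S}.ncard ∈ ({1, 2} : Set ℕ))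
    (hP5 : ∀ P : Set (Sym2 V), MemFam G P → P.ncard ∉ ({1, 2, 3, 4} : Set ℕ) →
      {x : V | (x, P) ∈ S}.ncard ∈ ({0, 1, 2} : Set ℕ)) :
    ∃ M Sf : Set (Sym2 V), IsMSFDecomp G k M Sf := by
  have hthread : ∀ P, MemFam G P → ∃ L ⊆ P,
      (∀ e ∈ L, ∀ f ∈ L, e ≠ f → ∀ v, 2 ≤ G.degree v → v ∈ e → v ∉ f) ∧
      (∀ v, 3 ≤ G.degree v → ((∃ e ∈ L, v ∈ e) ↔ (v, P) ∈ S)) ∧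
      (∀ e ∈ P, e ∉ L → ∃ v ∈ e, G.degree v = 2 ∧ ∃ f ∈ L, v ∈ f) := by
    intro P hP
    obtain ⟨g, n, h⟩ := hP.exists_isThread
    have hn := h.ncard_eq
    exact h.exists_matching (A := {x | (x, P) ∈ S})
      (fun x hx => ⟨(hS hx).1, (hS hx).2.2.exists_mem⟩)
      (fun h1 => hP1 P hP (hn.trans h1)) (fun h2 => hP2 P hP (hn.trans h2))
      (fun h3 => hP3 P hP (hn.trans h3)) (fun h4 => hP4 P hP (hn.trans h4))
  choose! L hLP hLmatch hLend hLstar using hthread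
  have hPedge : ∀ P, MemFam G P → P ⊆ G.edgeSet := by
    intro P hP
    obtain ⟨g, n, h⟩ := hP.exists_isThread
    exact h.subset_edgeSet
  set M : Set (Sym2 V) := {e | ∃ P, MemFam G P ∧ e ∈ L P} with hM
  have hMsub : M ⊆ G.edgeSet := by
    rintro e ⟨P, hP, he⟩
    exact hPedge P hP (hLP P hP he)
  have hmemL : ∀ P, MemFam G P → ∀ e ∈ P, e ∈ M → e ∈ L P := by
    rintro P hP e heP ⟨Q, hQ, heQ⟩
    rwa [eq_of_memFam_of_mem hP hQ heP (hLP Q hQ heQ)]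
  have hinc : ∀ v, (G.incidenceSet v).ncard = G.degree v := by
    intro v
    rw [← SimpleGraph.card_incidenceFinset_eq_degree, ← Set.ncard_coe_finset,
      SimpleGraph.coe_incidenceFinset]
  have hle : ∀ x, 3 ≤ G.degree x → {P | (x, P) ∈ S}.ncard ≤ 1 := by
    intro x hx
    by_cases hxk : k + 1 ≤ G.degree x
    · exact (Set.mem_singleton_iff.1 (hX1 x hxk)).le
    · rcases hX2 x hx hxk with h | h
      · rw [h]; exact zero_le_one
      · exact (Set.mem_singleton_iff.1 h).le
  have hmatch : ∀ e ∈ M, ∀ f ∈ M, e ≠ f → ∀ v : V, v ∈ e → v ∉ f := by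
    rintro e ⟨P, hP, heP⟩ f ⟨Q, hQ, hfQ⟩ hne v hve hvf
    have heG := hPedge P hP (hLP P hP heP)
    have hfG := hPedge Q hQ (hLP Q hQ hfQ)
    have hdeg : 2 ≤ G.degree v := by
      rw [← hinc v, ← Set.ncard_pair hne]
      apply Set.ncard_le_ncard _ (Set.toFinite _)
      rintro x (rfl | rfl)
      · exact ⟨heG, hve⟩
      · exact ⟨hfG, hvf⟩
    refine hLmatch P hP e heP f ?_ hne v hdeg hve hvf
    rcases hdeg.eq_or_lt with h2 | h3
    · obtain ⟨g, n, h⟩ := hP.exists_isThread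
      exact hmemL P hP f
        (h.closed_under_adjacency (hLP P hP heP) hfG hve hvf h2.symm) ⟨Q, hQ, hfQ⟩
    · have hvP := (hLend P hP v h3).1 ⟨e, heP, hve⟩
      have hvQ := (hLend Q hQ v h3).1 ⟨f, hfQ, hvf⟩
      rwa [(Set.ncard_le_one (Set.toFinite _)).1 (hle v h3) P hvP Q hvQ]
  refine ⟨M, G.edgeSet \ M, Set.union_sdiff_cancel hMsub, Set.disjoint_sdiff_right,
    ⟨hMsub, hmatch⟩, Set.sdiff_subset, ?_, ?_⟩
  · rintro e ⟨heG, heM⟩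
    obtain ⟨P, hP, heP⟩ := exists_memFam_of_mem_edgeSet G heG
    obtain ⟨v, hve, hv, f, hfL, hvf⟩ := hLstar P hP e heP (fun h => heM ⟨P, hP, h⟩)
    refine ⟨v, hve, Set.ncard_eq_one.2 ⟨e, ?_⟩⟩
    have hfM : f ∈ M := ⟨P, hP, hfL⟩
    ext x
    constructor
    · rintro ⟨⟨hxG, hxM⟩, hvx⟩
      rcases eq_or_eq_of_degree_two G hv heG (hMsub hfM) hxG hve hvf hvx
        (fun h => heM (h ▸ hfM)) with h | h
      · exact h
      · exact absurd (h ▸ hfM) hxM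
    · rintro rfl
      exact ⟨⟨heG, heM⟩, hve⟩
  · intro v
    by_cases hvk : k + 1 ≤ G.degree v
    · obtain ⟨P, hPeq⟩ := Set.ncard_eq_one.1 (Set.mem_singleton_iff.1 (hX1 v hvk))
      have hvP : (v, P) ∈ S := by
        have : P ∈ {P | (v, P) ∈ S} := by rw [hPeq]; rfl
        exact this
      have hP := (hS hvP).2.1
      obtain ⟨f, hfL, hvf⟩ := (hLend P hP v (by omega)).2 hvP
      have hfM : f ∈ M := ⟨P, hP, hfL⟩
      have hlt : {f ∈ G.edgeSet \ M | v ∈ f}.ncard < (G.incidenceSet v).ncard := by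
        apply Set.ncard_lt_ncard _ (Set.toFinite _)
        refine ⟨fun x hx => ⟨hx.1.1, hx.2⟩, fun hsub => ?_⟩
        exact (hsub ⟨hMsub hfM, hvf⟩ : f ∈ {f ∈ G.edgeSet \ M | v ∈ f}).1.2 hfM
      rw [hinc] at hlt
      have := hΔ v
      omega
    · have : {f ∈ G.edgeSet \ M | v ∈ f}.ncard ≤ (G.incidenceSet v).ncard :=
        Set.ncard_le_ncard (fun x hx => ⟨hx.1.1, hx.2⟩) (Set.toFinite _)
      rw [hinc] at this
      omega
end
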